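/- There exists R* > 0 such that the solution (x_{R*}, r_{R*}, θ_{R*}) of the arc-length system (1.5) with initial condition (1.6) has a finite first exit time t₁ = t₁(R*), and at this time x_{R*}(t₁) = 0, θ_{R*}(t₁) = −π, and r_{R*}(t₁) > 0. -/

import Mathlib

/-- The arc-length system (1.5): `x' = cos θ`, `r' = sin θ`,
`θ' = ((n-1)/r - (r/2) f'(x²+r²)) cos θ + (x/2) f'(x²+r²) sin θ` on the set `s`. -/
def SolvesSystem (n : ℕ) (f : ℝ → ℝ) (x r θ : ℝ → ℝ) (s : Set ℝ) : Prop :=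
  ∀ t ∈ s,
    HasDerivAt x (Real.cos (θ t)) t ∧
    HasDerivAt r (Real.sin (θ t)) t ∧
    HasDerivAt θ
      ((((n : ℝ) - 1) / r t - r t / 2 * deriv f (x t ^ 2 + r t ^ 2)) * Real.cos (θ t)
        + x t / 2 * deriv f (x t ^ 2 + r t ^ 2) * Real.sin (θ t)) t

/-- None of the exit events `θ = 0`, `θ = -π`, `x = 0`, `r = 0` occurs on `s`. -/
def NoExit (x r θ : ℝ → ℝ) (s : Set ℝ) : Prop :=
  ∀ t ∈ s, θ t ≠ 0 ∧ θ t ≠ -Real.pi ∧ x t ≠ 0 ∧ r t ≠ 0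

section

open Set Filter Topology

/-- A bounded globally Lipschitz vector field on a Banach space has global integral curves. -/
theorem exists_global_integralCurve {E : Type*} [NormedAddCommGroup E] [NormedSpace ℝ E]
    [CompleteSpace E] {v : E → E} {L C : NNReal} (hv : LipschitzWith L v)
    (hC : ∀ x, ‖v x‖ ≤ C) (x₀ : E) :
    ∃ γ : ℝ → E, γ 0 = x₀ ∧ ∀ t, HasDerivAt γ (v (γ t)) t := by
  have key : ∀ N : ℕ, ∃ α : ℝ → E, α 0 = x₀ ∧
      ∀ t ∈ Ioo (-((N : ℝ) + 1)) ((N : ℝ) + 1), HasDerivAt α (v (α t)) t := by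
    intro N
    have hN : (0 : ℝ) < (N : ℝ) + 1 := by positivity
    have hp : IsPicardLindelof (fun _ : ℝ => v)
        (⟨0, by constructor <;> linarith⟩ : Icc (-((N : ℝ) + 1)) ((N : ℝ) + 1)) x₀
        (C * ((N : NNReal) + 1)) 0 C L := by
      refine ⟨fun t _ => hv.lipschitzOnWith, fun x _ => continuousOn_const,
        fun t _ x _ => hC x, ?_⟩
      simp
    obtain ⟨α, h0, h⟩ := hp.exists_eq_forall_mem_Icc_hasDerivWithinAt₀
    exact ⟨α, h0, fun t ht => (h t (Ioo_subset_Icc_self ht)).hasDerivAt (Icc_mem_nhds ht.1 ht.2)⟩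
  choose α hα0 hα using key
  have agree : ∀ N N' : ℕ, N ≤ N' → EqOn (α N) (α N') (Ioo (-((N : ℝ) + 1)) ((N : ℝ) + 1)) := by
    intro N N' h
    have h' : (N : ℝ) ≤ N' := by exact_mod_cast h
    have hN : (0 : ℝ) < (N : ℝ) + 1 := by positivity
    refine ODE_solution_unique_of_mem_Ioo (v := fun _ => v) (s := fun _ => univ) (K := L) (t₀ := 0)
      (fun t _ => hv.lipschitzOnWith) ⟨by linarith, hN⟩ (fun t ht => ⟨hα N t ht, trivial⟩)
      (fun t ht => ⟨hα N' t ⟨by linarith [ht.1], by linarith [ht.2]⟩, trivial⟩)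
      (by rw [hα0, hα0])
  refine ⟨fun t => α ⌈|t|⌉₊ t, by simp [hα0], fun t => ?_⟩
  have hmem : ∀ t : ℝ, t ∈ Ioo (-((⌈|t|⌉₊ : ℝ) + 1)) ((⌈|t|⌉₊ : ℝ) + 1) := by
    intro t
    have := Nat.le_ceil |t|
    constructor <;> linarith [neg_abs_le t, le_abs_self t]
  refine (hα ⌈|t|⌉₊ t (hmem t)).congr_of_eventuallyEq ?_
  filter_upwards [Ioo_mem_nhds (hmem t).1 (hmem t).2] with u hu
  rcases le_total ⌈|u|⌉₊ ⌈|t|⌉₊ with h | h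
  · exact agree _ _ h (hmem u)
  · exact (agree _ _ h hu).symm

/-- Integral curves of a Lipschitz vector field separate at most exponentially. -/
theorem dist_integralCurve_le {E : Type*} [NormedAddCommGroup E] [NormedSpace ℝ E]
    {v : E → E} {L : NNReal} (hv : LipschitzWith L v) {γ₁ γ₂ : ℝ → E}
    (h₁ : ∀ t, HasDerivAt γ₁ (v (γ₁ t)) t) (h₂ : ∀ t, HasDerivAt γ₂ (v (γ₂ t)) t) (t : ℝ) :
    dist (γ₁ t) (γ₂ t) ≤ dist (γ₁ 0) (γ₂ 0) * Real.exp (L * |t|) := by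
  have main : ∀ (w : E → E), LipschitzWith L w → ∀ (β₁ β₂ : ℝ → E),
      (∀ t, HasDerivAt β₁ (w (β₁ t)) t) → (∀ t, HasDerivAt β₂ (w (β₂ t)) t) → ∀ t, 0 ≤ t →
      dist (β₁ t) (β₂ t) ≤ dist (β₁ 0) (β₂ 0) * Real.exp (L * t) := by
    intro w hw β₁ β₂ k₁ k₂ t ht
    have c₁ : Continuous β₁ := continuous_iff_continuousAt.2 fun t => (k₁ t).continuousAt
    have c₂ : Continuous β₂ := continuous_iff_continuousAt.2 fun t => (k₂ t).continuousAt
    have := dist_le_of_trajectories_ODE (v := fun _ => w) (a := 0) (b := t) (fun _ => hw)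
      c₁.continuousOn (fun t _ => (k₁ t).hasDerivWithinAt)
      c₂.continuousOn (fun t _ => (k₂ t).hasDerivWithinAt) le_rfl t ⟨ht, le_rfl⟩
    simpa using this
  rcases le_total 0 t with ht | ht
  · rw [abs_of_nonneg ht]
    exact main v hv γ₁ γ₂ h₁ h₂ t ht
  · rw [abs_of_nonpos ht]
    have hneg : ∀ γ : ℝ → E, (∀ t, HasDerivAt γ (v (γ t)) t) →
        ∀ t, HasDerivAt (fun t => γ (-t)) ((fun x => -v x) (γ (-t))) t := by
      intro γ h t
      have := (h (-t)).scomp t (hasDerivAt_neg t)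
      rw [neg_one_smul] at this
      exact this
    have := main (fun x => -v x) hv.neg _ _ (hneg γ₁ h₁) (hneg γ₂ h₂) (-t) (by linarith)
    simpa using this

theorem image_le_of_hasDerivAt_nonpos {g g' : ℝ → ℝ} {a b : ℝ} (hab : a ≤ b)
    (hg : ∀ s ∈ Icc a b, HasDerivAt g (g' s) s) (h : ∀ s ∈ Ioo a b, g' s ≤ 0) : g b ≤ g a := by
  refine antitoneOn_of_deriv_nonpos (convex_Icc a b)
    (fun s hs => (hg s hs).continuousAt.continuousWithinAt)
    (fun s hs => ?_) (fun s hs => ?_) (left_mem_Icc.2 hab) (right_mem_Icc.2 hab) hab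
  · rw [interior_Icc] at hs
    exact (hg s (Ioo_subset_Icc_self hs)).differentiableAt.differentiableWithinAt
  · rw [interior_Icc] at hs
    rw [(hg s (Ioo_subset_Icc_self hs)).deriv]
    exact h s hs

theorem image_lt_of_hasDerivAt_neg {g g' : ℝ → ℝ} {a b : ℝ} (hab : a < b)
    (hg : ∀ s ∈ Icc a b, HasDerivAt g (g' s) s) (h : ∀ s ∈ Ioo a b, g' s < 0) : g b < g a := by
  refine strictAntiOn_of_deriv_neg (convex_Icc a b)
    (fun s hs => (hg s hs).continuousAt.continuousWithinAt)
    (fun s hs => ?_) (left_mem_Icc.2 hab.le) (right_mem_Icc.2 hab.le) hab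
  rw [interior_Icc] at hs
  rw [(hg s (Ioo_subset_Icc_self hs)).deriv]
  exact h s hs

theorem forall_mem_or_exists_first_exit {E : Type*} [TopologicalSpace E] {U : Set E}
    (hU : IsOpen U) {γ : ℝ → E} (hγ : Continuous γ) {ε : ℝ} (hε : 0 < ε)
    (h : ∀ s ∈ Ioc 0 ε, γ s ∈ U) :
    (∀ s, 0 < s → γ s ∈ U) ∨ ∃ s₁, 0 < s₁ ∧ (∀ s ∈ Ioo 0 s₁, γ s ∈ U) ∧ γ s₁ ∉ U := by
  by_cases hall : ∀ s, 0 < s → γ s ∈ U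
  · exact Or.inl hall
  · right
    push Not at hall
    obtain ⟨s', hs', hbad⟩ := hall
    set S : Set ℝ := Ici ε ∩ γ ⁻¹' Uᶜ
    have hS : IsClosed S := isClosed_Ici.inter (hU.isClosed_compl.preimage hγ)
    have hεs' : ε ≤ s' := by
      by_contra hlt
      exact hbad (h s' ⟨hs', by linarith⟩)
    have hne : S.Nonempty := ⟨s', hεs', hbad⟩
    have hbd : BddBelow S := ⟨ε, fun s hs => hs.1⟩
    have hmem := hS.csInf_mem hne hbd
    refine ⟨sInf S, lt_of_lt_of_le hε hmem.1, fun s hs => ?_, hmem.2⟩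
    by_contra hsU
    rcases le_total s ε with hle | hle
    · exact hsU (h s ⟨hs.1, hle⟩)
    · exact absurd (csInf_le hbd (show s ∈ S from ⟨hle, hsU⟩)) (not_le.2 hs.2)

/-- The standing assumptions on the weight `f`. -/
structure ConvexWeight (m M : ℝ) (f : ℝ → ℝ) : Prop where
  pos : 0 < m
  contDiff : ContDiff ℝ 2 f
  mono : Monotone (deriv f)
  low : ∀ s, m ≤ deriv f s
  up : ∀ s, deriv f s ≤ M

/-- The arc-length system in the conformal time `s` with `dt = r ds`, at the time `s`;
here `k = n - 1`. -/
def ConformalSystem (k : ℕ) (f : ℝ → ℝ) (x r θ : ℝ → ℝ) (s : ℝ) : Prop :=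
  HasDerivAt x (r s * Real.cos (θ s)) s ∧
  HasDerivAt r (r s * Real.sin (θ s)) s ∧
  HasDerivAt θ (((k : ℝ) - r s ^ 2 / 2 * deriv f (x s ^ 2 + r s ^ 2)) * Real.cos (θ s)
    + x s * r s / 2 * deriv f (x s ^ 2 + r s ^ 2) * Real.sin (θ s)) s

/-- The weight of the length functional whose critical points are the profile curves. -/
noncomputable def weight (k : ℕ) (f : ℝ → ℝ) (a b : ℝ) : ℝ :=
  b ^ k * Real.exp (-f (a ^ 2 + b ^ 2) / 4)

theorem weight_pos (k : ℕ) (f : ℝ → ℝ) {a b : ℝ} (hb : 0 < b) : 0 < weight k f a b := by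
  unfold weight; positivity

theorem ConvexWeight.hasDerivAt {m M : ℝ} {f : ℝ → ℝ} (hf : ConvexWeight m M f) (s : ℝ) :
    HasDerivAt f (deriv f s) s :=
  (hf.contDiff.differentiable (by norm_num) s).hasDerivAt

theorem ConvexWeight.continuous_deriv {m M : ℝ} {f : ℝ → ℝ} (hf : ConvexWeight m M f) :
    Continuous (deriv f) :=
  hf.contDiff.continuous_deriv (by norm_num)

theorem ConvexWeight.deriv_pos {m M : ℝ} {f : ℝ → ℝ} (hf : ConvexWeight m M f) (s : ℝ) :
    0 < deriv f s := hf.pos.trans_le (hf.low s)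

theorem ConvexWeight.add_mul_sub_le {m M : ℝ} {f : ℝ → ℝ} (hf : ConvexWeight m M f) {a b : ℝ}
    (hab : a ≤ b) : f a + m * (b - a) ≤ f b := by
  have h : m * b - f b ≤ m * a - f a := image_le_of_hasDerivAt_nonpos (g := fun s => m * s - f s)
    (g' := fun s => m * 1 - deriv f s) hab
    (fun s _ => ((hasDerivAt_id s).const_mul m).sub (hf.hasDerivAt s))
    (fun s _ => by linarith [hf.low s])
  linarith

theorem ConvexWeight.monotone {m M : ℝ} {f : ℝ → ℝ} (hf : ConvexWeight m M f) : Monotone f := by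
  intro a b hab
  nlinarith [hf.add_mul_sub_le hab, mul_nonneg hf.pos.le (sub_nonneg.2 hab)]

theorem ConvexWeight.mul_deriv_lt {m M : ℝ} {f : ℝ → ℝ} (hf : ConvexWeight m M f) {a b : ℝ}
    (ha : 0 ≤ a) (hab : a < b) : a * deriv f a < b * deriv f b := by
  nlinarith [hf.mono hab.le, hf.deriv_pos b]

section identities

variable {k : ℕ} {m M : ℝ} {f : ℝ → ℝ} {x r θ : ℝ → ℝ} {s : ℝ}

theorem ConformalSystem.hasDerivAt_normSq (h : ConformalSystem k f x r θ s) :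
    HasDerivAt (fun s => x s ^ 2 + r s ^ 2)
      (2 * (r s * (x s * Real.cos (θ s) + r s * Real.sin (θ s)))) s := by
  obtain ⟨hx, hr, _⟩ := h
  refine ((hx.pow 2).add (hr.pow 2)).congr_deriv ?_
  push_cast
  ring

theorem ConformalSystem.hasDerivAt_weight (hf : ConvexWeight m M f)
    (h : ConformalSystem k f x r θ s) :
    HasDerivAt (fun s => weight k f (x s) (r s)) (weight k f (x s) (r s) *
      (k * Real.sin (θ s) - deriv f (x s ^ 2 + r s ^ 2) / 2 *
        (r s * (x s * Real.cos (θ s) + r s * Real.sin (θ s))))) s := by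
  have h1 := (((hf.hasDerivAt _).comp s h.hasDerivAt_normSq).neg.div_const 4).exp
  have h2 := (h.2.1.pow k).mul h1
  refine h2.congr_deriv ?_
  rcases k with _ | k
  · simp [weight]; ring
  · simp [weight, pow_succ]; ring

theorem ConformalSystem.hasDerivAt_radial (h : ConformalSystem k f x r θ s) :
    HasDerivAt (fun s => x s * Real.cos (θ s) + r s * Real.sin (θ s))
      (r s + (r s * Real.cos (θ s) - x s * Real.sin (θ s)) *
        (((k : ℝ) - r s ^ 2 / 2 * deriv f (x s ^ 2 + r s ^ 2)) * Real.cos (θ s)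
    + x s * r s / 2 * deriv f (x s ^ 2 + r s ^ 2) * Real.sin (θ s))) s := by
  obtain ⟨hx, hr, hθ⟩ := h
  refine ((hx.mul hθ.cos).add (hr.mul hθ.sin)).congr_deriv ?_
  linear_combination r s * Real.sin_sq_add_cos_sq (θ s)

theorem ConformalSystem.hasDerivAt_support (h : ConformalSystem k f x r θ s) :
    HasDerivAt (fun s => r s * Real.cos (θ s) - x s * Real.sin (θ s))
      (-(x s * Real.cos (θ s) + r s * Real.sin (θ s)) *
        (((k : ℝ) - r s ^ 2 / 2 * deriv f (x s ^ 2 + r s ^ 2)) * Real.cos (θ s)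
    + x s * r s / 2 * deriv f (x s ^ 2 + r s ^ 2) * Real.sin (θ s))) s := by
  obtain ⟨hx, hr, hθ⟩ := h
  refine ((hr.mul hθ.cos).sub (hx.mul hθ.sin)).congr_deriv ?_
  ring

/-- First variation of the weighted length under dilations. -/
theorem ConformalSystem.hasDerivAt_weight_mul_radial (hf : ConvexWeight m M f)
    (h : ConformalSystem k f x r θ s) :
    HasDerivAt (fun s => weight k f (x s) (r s) *
        (x s * Real.cos (θ s) + r s * Real.sin (θ s)))
      (weight k f (x s) (r s) * (r s * ((k : ℝ) + 1 -
        (x s ^ 2 + r s ^ 2) * deriv f (x s ^ 2 + r s ^ 2) / 2))) s := by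
  refine ((h.hasDerivAt_weight hf).mul h.hasDerivAt_radial).congr_deriv ?_
  linear_combination (weight k f (x s) (r s) * r s * (k -
    (x s ^ 2 + r s ^ 2) * deriv f (x s ^ 2 + r s ^ 2) / 2)) * Real.sin_sq_add_cos_sq (θ s)

/-- First variation of the weighted length under rotations. -/
theorem ConformalSystem.hasDerivAt_weight_mul_support (hf : ConvexWeight m M f)
    (h : ConformalSystem k f x r θ s) :
    HasDerivAt (fun s => weight k f (x s) (r s) *
        (r s * Real.cos (θ s) - x s * Real.sin (θ s)))
      (-(k * (weight k f (x s) (r s) * x s))) s := by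
  refine ((h.hasDerivAt_weight hf).mul h.hasDerivAt_support).congr_deriv ?_
  linear_combination (-weight k f (x s) (r s) * x s * k) * Real.sin_sq_add_cos_sq (θ s)

/-- First variation of the weighted length under horizontal translations. -/
theorem ConformalSystem.hasDerivAt_weight_mul_cos (hf : ConvexWeight m M f)
    (h : ConformalSystem k f x r θ s) :
    HasDerivAt (fun s => weight k f (x s) (r s) * Real.cos (θ s))
      (-(r s * (weight k f (x s) (r s) * x s) * deriv f (x s ^ 2 + r s ^ 2) / 2)) s := by
  refine ((h.hasDerivAt_weight hf).mul h.2.2.cos).congr_deriv ?_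
  linear_combination (-(r s * (weight k f (x s) (r s) * x s) * deriv f (x s ^ 2 + r s ^ 2) / 2)) *
    Real.sin_sq_add_cos_sq (θ s)

end identities

/-- The solutions of the conformal system shot horizontally from the points `(0, R)`, extended to
global curves by modifying the vector field outside a box of size `K`. -/
structure ShootingFamily (k : ℕ) (f : ℝ → ℝ) (K : ℝ) (x r θ : ℝ → ℝ → ℝ) : Prop where
  x_zero : ∀ R, x R 0 = 0
  r_zero : ∀ R, r R 0 = R
  θ_zero : ∀ R, θ R 0 = 0
  x_cont : Continuous fun p : ℝ × ℝ => x p.1 p.2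
  r_cont : Continuous fun p : ℝ × ℝ => r p.1 p.2
  θ_cont : Continuous fun p : ℝ × ℝ => θ p.1 p.2
  r_pos : ∀ R s, 0 < R → 0 ≤ s → 0 < r R s
  system : ∀ R s, |x R s| ≤ K → |r R s| ≤ K → |θ R s| ≤ 4 →
    ConformalSystem k f (x R) (r R) (θ R) s
  unique : ∀ R, ∀ y ρ φ : ℝ → ℝ, y 0 = 0 → ρ 0 = R → φ 0 = 0 →
    (∀ s, |y s| ≤ K ∧ |ρ s| ≤ K ∧ |φ s| ≤ 4 ∧ ConformalSystem k f y ρ φ s) →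
    ∀ s, x R s = y s ∧ r R s = ρ s ∧ θ R s = φ s

/-- The truncation of a real number to the interval `[-K, K]`. -/
noncomputable def truncate (K a : ℝ) : ℝ := max (-K) (min K a)

theorem lipschitzWith_truncate (K : ℝ) : LipschitzWith 1 (truncate K) :=
  (LipschitzWith.id.const_min K).const_max (-K)

theorem abs_truncate_le {K : ℝ} (hK : 0 ≤ K) (a : ℝ) : |truncate K a| ≤ K := by
  unfold truncate
  exact abs_le.2 ⟨le_max_left _ _, max_le (by linarith) (min_le_left _ _)⟩

theorem truncate_eq {K a : ℝ} (h : |a| ≤ K) : truncate K a = a := by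
  have := abs_le.1 h
  unfold truncate
  rw [min_eq_right this.2, max_eq_right this.1]

theorem abs_mul_truncate_le {K : ℝ} (hK : 0 ≤ K) (a : ℝ) : |a * truncate K a| ≤ a ^ 2 := by
  have : |truncate K a| ≤ |a| := by
    rcases le_total |a| K with h | h
    · rw [truncate_eq h]
    · exact (abs_truncate_le hK a).trans h
  rw [abs_mul, ← sq_abs a, sq]
  exact mul_le_mul_of_nonneg_left this (abs_nonneg a)

/-- The vector field of the conformal system. -/
noncomputable def conformalField (k : ℕ) (f : ℝ → ℝ) (p : ℝ × ℝ × ℝ) : ℝ × ℝ × ℝ :=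
  (p.2.1 * Real.cos p.2.2, p.2.1 * Real.sin p.2.2,
    ((k : ℝ) - p.2.1 ^ 2 / 2 * deriv f (p.1 ^ 2 + p.2.1 ^ 2)) * Real.cos p.2.2
    + p.1 * p.2.1 / 2 * deriv f (p.1 ^ 2 + p.2.1 ^ 2) * Real.sin p.2.2)

/-- The truncation of a point of phase space to a box. -/
noncomputable def truncatePhase (K : ℝ) (p : ℝ × ℝ × ℝ) : ℝ × ℝ × ℝ :=
  (truncate K p.1, truncate K p.2.1, truncate 4 p.2.2)

theorem lipschitzWith_truncatePhase (K : ℝ) : LipschitzWith 1 (truncatePhase K) := by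
  have h1 : LipschitzWith 1 fun p : ℝ × ℝ × ℝ => truncate K p.1 := by
    simpa [Function.comp_def] using (lipschitzWith_truncate K).comp LipschitzWith.prod_fst
  have h2 : LipschitzWith 1 fun p : ℝ × ℝ × ℝ => truncate K p.2.1 := by
    simpa [Function.comp_def] using (lipschitzWith_truncate K).comp
      (LipschitzWith.prod_fst.comp LipschitzWith.prod_snd)
  have h3 : LipschitzWith 1 fun p : ℝ × ℝ × ℝ => truncate 4 p.2.2 := by
    simpa [Function.comp_def] using (lipschitzWith_truncate 4).comp
      (LipschitzWith.prod_snd.comp LipschitzWith.prod_snd)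
  unfold truncatePhase
  simpa using h1.prodMk (h2.prodMk h3)

theorem ConvexWeight.contDiff_conformalField {m M : ℝ} {f : ℝ → ℝ} (hf : ConvexWeight m M f)
    (k : ℕ) : ContDiff ℝ 1 (conformalField k f) := by
  have hd : ContDiff ℝ 1 (deriv f) := by
    have h : ContDiff ℝ (1 + 1) f := by
      have := hf.contDiff
      norm_num
      exact this
    exact (contDiff_succ_iff_deriv.1 h).2.2
  have hd' : ContDiff ℝ 1 fun p : ℝ × ℝ × ℝ => deriv f (p.1 ^ 2 + p.2.1 ^ 2) :=
    hd.comp (by fun_prop)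
  have hc : ContDiff ℝ 1 fun p : ℝ × ℝ × ℝ => Real.cos p.2.2 :=
    Real.contDiff_cos.comp (by fun_prop)
  have hs : ContDiff ℝ 1 fun p : ℝ × ℝ × ℝ => Real.sin p.2.2 :=
    Real.contDiff_sin.comp (by fun_prop)
  unfold conformalField
  fun_prop

theorem ConvexWeight.exists_shootingFamily {m M : ℝ} {f : ℝ → ℝ} (hf : ConvexWeight m M f)
    (k : ℕ) {K : ℝ} (hK : 0 ≤ K) : ∃ x r θ : ℝ → ℝ → ℝ, ShootingFamily k f K x r θ := by
  have hG := hf.contDiff_conformalField k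
  set B : Set (ℝ × ℝ × ℝ) := Icc (-K) K ×ˢ Icc (-K) K ×ˢ Icc (-4) 4
  have hB : IsCompact B := isCompact_Icc.prod (isCompact_Icc.prod isCompact_Icc)
  have hmaps : ∀ p, truncatePhase K p ∈ B := fun p =>
    ⟨abs_le.1 (abs_truncate_le hK _), abs_le.1 (abs_truncate_le hK _),
      abs_le.1 (abs_truncate_le (by norm_num) _)⟩
  obtain ⟨L, hL⟩ : ∃ L, LipschitzOnWith L (conformalField k f) B :=
    LocallyLipschitzOn.exists_lipschitzOnWith_of_compact hB
      hG.locallyLipschitz.locallyLipschitzOn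
  obtain ⟨C, hC⟩ := hB.exists_bound_of_continuousOn hG.continuous.continuousOn
  set v : ℝ × ℝ × ℝ → ℝ × ℝ × ℝ := fun p => conformalField k f (truncatePhase K p) with hv
  have hvL : LipschitzWith L v := by
    have := hL.comp ((lipschitzWith_truncatePhase K).lipschitzOnWith (s := univ))
      (fun p _ => hmaps p)
    rw [mul_one, lipschitzOnWith_univ] at this
    exact this
  have hvC : ∀ p, ‖v p‖ ≤ C.toNNReal := fun p => (hC _ (hmaps p)).trans (Real.le_coe_toNNReal C)
  choose γ hγ0 hγ using fun R : ℝ => exists_global_integralCurve hvL hvC ((0, R, 0) : ℝ × ℝ × ℝ)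
  have hγc : ∀ R, Continuous (γ R) := fun R =>
    continuous_iff_continuousAt.2 fun t => (hγ R t).continuousAt
  have hcont : Continuous fun p : ℝ × ℝ => γ p.1 p.2 := by
    rw [continuous_iff_continuousAt]
    rintro ⟨R₀, s₀⟩
    refine tendsto_iff_dist_tendsto_zero.2 (squeeze_zero (fun _ => dist_nonneg)
      (g := fun p : ℝ × ℝ => dist (γ p.1 0) (γ R₀ 0) * Real.exp (L * |p.2|) +
        dist (γ R₀ p.2) (γ R₀ s₀)) (fun p => ?_) ?_)
    · exact (dist_triangle _ (γ R₀ p.2) _).trans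
        (add_le_add_left (dist_integralCurve_le hvL (hγ _) (hγ _) _) _)
    · have : Continuous fun p : ℝ × ℝ => dist (γ p.1 0) (γ R₀ 0) * Real.exp (L * |p.2|) +
        dist (γ R₀ p.2) (γ R₀ s₀) := by
        simp only [hγ0]
        have := (hγc R₀).comp (continuous_snd : Continuous (Prod.snd : ℝ × ℝ → ℝ))
        simp only [Function.comp_def] at this
        fun_prop
      convert this.tendsto (R₀, s₀) using 2
      simp
  have hx : ∀ R s, HasDerivAt (fun s => (γ R s).1) (v (γ R s)).1 s := fun R s =>
    (ContinuousLinearMap.fst ℝ ℝ (ℝ × ℝ)).hasFDerivAt.comp_hasDerivAt s (hγ R s)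
  have h2 : ∀ R s, HasDerivAt (fun s => (γ R s).2) (v (γ R s)).2 s := fun R s =>
    (ContinuousLinearMap.snd ℝ ℝ (ℝ × ℝ)).hasFDerivAt.comp_hasDerivAt s (hγ R s)
  have hr : ∀ R s, HasDerivAt (fun s => (γ R s).2.1) (v (γ R s)).2.1 s := fun R s =>
    (ContinuousLinearMap.fst ℝ ℝ ℝ).hasFDerivAt.comp_hasDerivAt s (h2 R s)
  have hθ : ∀ R s, HasDerivAt (fun s => (γ R s).2.2) (v (γ R s)).2.2 s := fun R s =>
    (ContinuousLinearMap.snd ℝ ℝ ℝ).hasFDerivAt.comp_hasDerivAt s (h2 R s)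
  have htr : ∀ p : ℝ × ℝ × ℝ, |p.1| ≤ K → |p.2.1| ≤ K → |p.2.2| ≤ 4 →
      v p = conformalField k f p := by
    intro p h1 h2 h3
    have : truncatePhase K p = p := by
      unfold truncatePhase
      rw [truncate_eq h1, truncate_eq h2, truncate_eq h3]
    rw [hv]
    simp only [this]
  refine ⟨fun R s => (γ R s).1, fun R s => (γ R s).2.1, fun R s => (γ R s).2.2,
    fun R => by simp [hγ0], fun R => by simp [hγ0], fun R => by simp [hγ0],
    hcont.fst, hcont.snd.fst, hcont.snd.snd, ?_, ?_, ?_⟩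
  · intro R s hR hs
    have hne : ∀ s, 0 ≤ s → (γ R s).2.1 ≠ 0 := by
      intro s hs h0
      have key := image_le_of_hasDerivAt_nonpos
        (g := fun s => -((γ R s).2.1 ^ 2 * Real.exp (2 * s))) hs
        (fun s _ => (((hr R s).pow 2).mul ((hasDerivAt_id s).const_mul 2).exp).neg) ?_
      · simp only [h0, hγ0] at key
        norm_num at key
        nlinarith
      · intro s _
        have hb := abs_le.1 (abs_mul_truncate_le hK (γ R s).2.1)
        have hsin := Real.neg_one_le_sin (truncate 4 (γ R s).2.2)
        have hsin' := Real.sin_le_one (truncate 4 (γ R s).2.2)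
        have hb2 : -(γ R s).2.1 ^ 2 ≤ (γ R s).2.1 * (v (γ R s)).2.1 := by
          have e : (v (γ R s)).2.1 = truncate K (γ R s).2.1 *
            Real.sin (truncate 4 (γ R s).2.2) := rfl
          have hab : |(γ R s).2.1 * truncate K (γ R s).2.1 *
              Real.sin (truncate 4 (γ R s).2.2)| ≤ (γ R s).2.1 ^ 2 := by
            rw [abs_mul]
            exact (mul_le_of_le_one_right (abs_nonneg _) (Real.abs_sin_le_one _)).trans
              (abs_mul_truncate_le hK _)
          rw [e, ← mul_assoc]
          exact (abs_le.1 hab).1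
        have he := Real.exp_pos (2 * s)
        have := mul_nonneg he.le (sub_nonneg.2 hb2)
        simp only [id]
        norm_num
        nlinarith
    by_contra hle
    push Not at hle
    have : (0 : ℝ) ∈ (fun s => (γ R s).2.1) '' Icc 0 s := by
      refine intermediate_value_Icc' hs (hγc R).snd.fst.continuousOn ⟨hle, ?_⟩
      simp [hγ0, hR.le]
    obtain ⟨u, hu, hu0⟩ := this
    exact hne u hu.1 hu0
  · intro R s h1 h2 h3
    have e := htr (γ R s) h1 h2 h3
    refine ⟨?_, ?_, ?_⟩
    · exact (hx R s).congr_deriv (by rw [e]; rfl)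
    · exact (hr R s).congr_deriv (by rw [e]; rfl)
    · exact (hθ R s).congr_deriv (by rw [e]; rfl)
  · intro R y ρ φ hy hρ hφ hall s
    have hd : ∀ s, HasDerivAt (fun s => (y s, ρ s, φ s)) (v (y s, ρ s, φ s)) s := by
      intro s
      obtain ⟨h1, h2, h3, hsx, hsr, hsθ⟩ := hall s
      rw [htr (y s, ρ s, φ s) h1 h2 h3]
      exact hsx.prodMk (hsr.prodMk hsθ)
    have := dist_integralCurve_le hvL (hγ R) hd s
    simp only [hγ0, hy, hρ, hφ, dist_self, zero_mul] at this
    have e := dist_le_zero.1 this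
    simp [e]

/-- The open region of phase space in which the curves descend from the `r`-axis. -/
structure InRegion (K a b φ : ℝ) : Prop where
  x_pos : 0 < a
  r_pos : 0 < b
  θ_gt : -Real.pi < φ
  θ_neg : φ < 0
  radial_neg : a * Real.cos φ + b * Real.sin φ < 0
  normSq_lt : a ^ 2 + b ^ 2 < K ^ 2

theorem isOpen_inRegion (K : ℝ) : IsOpen {p : ℝ × ℝ × ℝ | InRegion K p.1 p.2.1 p.2.2} := by
  have e : {p : ℝ × ℝ × ℝ | InRegion K p.1 p.2.1 p.2.2} =
      {p | 0 < p.1} ∩ ({p | 0 < p.2.1} ∩ ({p | -Real.pi < p.2.2} ∩ ({p | p.2.2 < 0} ∩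
        ({p | p.1 * Real.cos p.2.2 + p.2.1 * Real.sin p.2.2 < 0} ∩
          {p | p.1 ^ 2 + p.2.1 ^ 2 < K ^ 2})))) := by
    ext p
    exact ⟨fun h => ⟨h.1, h.2, h.3, h.4, h.5, h.6⟩, fun h => ⟨h.1, h.2.1, h.2.2.1, h.2.2.2.1,
      h.2.2.2.2.1, h.2.2.2.2.2⟩⟩
  rw [e]
  refine (isOpen_lt ?_ ?_).inter ((isOpen_lt ?_ ?_).inter ((isOpen_lt ?_ ?_).inter
    ((isOpen_lt ?_ ?_).inter ((isOpen_lt ?_ ?_).inter (isOpen_lt ?_ ?_))))) <;> fun_prop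

theorem InRegion.abs_le {K a b φ : ℝ} (hK : 0 ≤ K) (h : InRegion K a b φ) :
    |a| ≤ K ∧ |b| ≤ K ∧ |φ| ≤ 4 := by
  refine ⟨abs_le_of_sq_le_sq (by nlinarith [h.normSq_lt, sq_nonneg b]) hK,
    abs_le_of_sq_le_sq (by nlinarith [h.normSq_lt, sq_nonneg a]) hK, ?_⟩
  have := Real.pi_lt_four
  exact _root_.abs_le.2 ⟨by linarith [h.θ_gt], by linarith [h.θ_neg]⟩

/-- A solution of the conformal system starting vertically above the origin, which stays in the
descending region on the open time interval from `0` to `b`. -/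
structure Descent (k : ℕ) (f : ℝ → ℝ) (R b : ℝ) (x r θ : ℝ → ℝ) : Prop where
  end_pos : 0 < b
  radius_pos : 0 < R
  x_zero : x 0 = 0
  r_zero : r 0 = R
  θ_zero : θ 0 = 0
  system : ∀ s ∈ Icc 0 b, ConformalSystem k f x r θ s
  r_pos : ∀ s ∈ Icc 0 b, 0 < r s
  x_pos : ∀ s ∈ Ioo 0 b, 0 < x s
  θ_gt : ∀ s ∈ Ioo 0 b, -Real.pi < θ s
  θ_neg : ∀ s ∈ Ioo 0 b, θ s < 0
  radial_neg : ∀ s ∈ Ioo 0 b, x s * Real.cos (θ s) + r s * Real.sin (θ s) < 0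

/-- A closed condition holding on an open interval holds on the closed interval. -/
theorem le_of_forall_mem_Ioo {u v : ℝ → ℝ} {a b : ℝ} (hab : a < b) (hu : ContinuousOn u (Icc a b))
    (hv : ContinuousOn v (Icc a b)) (h : ∀ s ∈ Ioo a b, u s ≤ v s) : ∀ s ∈ Icc a b, u s ≤ v s := by
  have hc := closure_Ioo hab.ne
  intro s hs
  rw [← hc] at hs hu hv
  exact ContinuousWithinAt.closure_le hs ((hu s hs).mono subset_closure)
    ((hv s hs).mono subset_closure) h

namespace Descent

variable {k : ℕ} {f : ℝ → ℝ} {R b : ℝ} {x r θ : ℝ → ℝ}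

theorem restrict (h : Descent k f R b x r θ) {c : ℝ} (hc : 0 < c) (hcb : c ≤ b) :
    Descent k f R c x r θ :=
  ⟨hc, h.radius_pos, h.x_zero, h.r_zero, h.θ_zero, fun s hs => h.system s ⟨hs.1, hs.2.trans hcb⟩,
    fun s hs => h.r_pos s ⟨hs.1, hs.2.trans hcb⟩, fun s hs => h.x_pos s ⟨hs.1, hs.2.trans_le hcb⟩,
    fun s hs => h.θ_gt s ⟨hs.1, hs.2.trans_le hcb⟩, fun s hs => h.θ_neg s ⟨hs.1, hs.2.trans_le hcb⟩,
    fun s hs => h.radial_neg s ⟨hs.1, hs.2.trans_le hcb⟩⟩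

theorem x_cont (h : Descent k f R b x r θ) : ContinuousOn x (Icc 0 b) :=
  fun s hs => (h.system s hs).1.continuousAt.continuousWithinAt

theorem r_cont (h : Descent k f R b x r θ) : ContinuousOn r (Icc 0 b) :=
  fun s hs => (h.system s hs).2.1.continuousAt.continuousWithinAt

theorem θ_cont (h : Descent k f R b x r θ) : ContinuousOn θ (Icc 0 b) :=
  fun s hs => (h.system s hs).2.2.continuousAt.continuousWithinAt

theorem x_nonneg (h : Descent k f R b x r θ) : ∀ s ∈ Icc 0 b, 0 ≤ x s :=
  le_of_forall_mem_Ioo h.end_pos continuousOn_const h.x_cont fun s hs => (h.x_pos s hs).le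

theorem θ_ge (h : Descent k f R b x r θ) : ∀ s ∈ Icc 0 b, -Real.pi ≤ θ s :=
  le_of_forall_mem_Ioo h.end_pos continuousOn_const h.θ_cont fun s hs => (h.θ_gt s hs).le

theorem θ_nonpos (h : Descent k f R b x r θ) : ∀ s ∈ Icc 0 b, θ s ≤ 0 :=
  le_of_forall_mem_Ioo h.end_pos h.θ_cont continuousOn_const fun s hs => (h.θ_neg s hs).le

theorem radial_nonpos (h : Descent k f R b x r θ) :
    ∀ s ∈ Icc 0 b, x s * Real.cos (θ s) + r s * Real.sin (θ s) ≤ 0 :=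
  le_of_forall_mem_Ioo h.end_pos ((h.x_cont.mul (Real.continuous_cos.comp_continuousOn h.θ_cont)).add
    (h.r_cont.mul (Real.continuous_sin.comp_continuousOn h.θ_cont)))
    continuousOn_const fun s hs => (h.radial_neg s hs).le

theorem sin_neg (h : Descent k f R b x r θ) : ∀ s ∈ Ioo 0 b, Real.sin (θ s) < 0 :=
  fun s hs => Real.sin_neg_of_neg_of_neg_pi_lt (h.θ_neg s hs) (h.θ_gt s hs)

theorem sin_nonpos (h : Descent k f R b x r θ) : ∀ s ∈ Icc 0 b, Real.sin (θ s) ≤ 0 :=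
  fun s hs => Real.sin_nonpos_of_nonpos_of_neg_pi_le (h.θ_nonpos s hs) (h.θ_ge s hs)

theorem r_lt (h : Descent k f R b x r θ) {s t : ℝ} (hs : 0 ≤ s) (hst : s < t) (ht : t ≤ b) :
    r t < r s :=
  image_lt_of_hasDerivAt_neg hst
    (fun u hu => (h.system u ⟨hs.trans hu.1, hu.2.trans ht⟩).2.1)
    (fun u hu => mul_neg_of_pos_of_neg (h.r_pos u ⟨by linarith [hu.1], by linarith [hu.2]⟩)
      (h.sin_neg u ⟨by linarith [hu.1], by linarith [hu.2]⟩))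

theorem r_le (h : Descent k f R b x r θ) {s t : ℝ} (hs : 0 ≤ s) (hst : s ≤ t) (ht : t ≤ b) :
    r t ≤ r s := by
  rcases hst.eq_or_lt with rfl | hst
  · exact le_rfl
  · exact (h.r_lt hs hst ht).le

theorem normSq_lt (h : Descent k f R b x r θ) {s t : ℝ} (hs : 0 ≤ s) (hst : s < t) (ht : t ≤ b) :
    x t ^ 2 + r t ^ 2 < x s ^ 2 + r s ^ 2 :=
  image_lt_of_hasDerivAt_neg (g := fun s => x s ^ 2 + r s ^ 2) hst
    (fun u hu => (h.system u ⟨hs.trans hu.1, hu.2.trans ht⟩).hasDerivAt_normSq)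
    (fun u hu => mul_neg_of_pos_of_neg two_pos
      (mul_neg_of_pos_of_neg (h.r_pos u ⟨by linarith [hu.1], by linarith [hu.2]⟩)
        (h.radial_neg u ⟨by linarith [hu.1], by linarith [hu.2]⟩)))

theorem normSq_le (h : Descent k f R b x r θ) {s : ℝ} (hs : s ∈ Icc 0 b) :
    x s ^ 2 + r s ^ 2 ≤ R ^ 2 := by
  rcases hs.1.eq_or_lt with rfl | h0
  · simp [h.x_zero, h.r_zero]
  · have := h.normSq_lt le_rfl h0 hs.2
    simp only [h.x_zero, h.r_zero] at this
    linarith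

end Descent

theorem ShootingFamily.continuous_x {k : ℕ} {f : ℝ → ℝ} {K : ℝ} {x r θ : ℝ → ℝ → ℝ}
    (F : ShootingFamily k f K x r θ) (R : ℝ) : Continuous (x R) :=
  F.x_cont.comp (by fun_prop : Continuous fun s : ℝ => (R, s))

theorem ShootingFamily.continuous_r {k : ℕ} {f : ℝ → ℝ} {K : ℝ} {x r θ : ℝ → ℝ → ℝ}
    (F : ShootingFamily k f K x r θ) (R : ℝ) : Continuous (r R) :=
  F.r_cont.comp (by fun_prop : Continuous fun s : ℝ => (R, s))

theorem ShootingFamily.continuous_θ {k : ℕ} {f : ℝ → ℝ} {K : ℝ} {x r θ : ℝ → ℝ → ℝ}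
    (F : ShootingFamily k f K x r θ) (R : ℝ) : Continuous (θ R) :=
  F.θ_cont.comp (by fun_prop : Continuous fun s : ℝ => (R, s))

theorem ShootingFamily.descent {k : ℕ} {f : ℝ → ℝ} {K : ℝ} {x r θ : ℝ → ℝ → ℝ}
    (F : ShootingFamily k f K x r θ) {R b : ℝ} (hR : 0 < R) (hRK : R ≤ K) (hb : 0 < b)
    (h : ∀ s ∈ Ioo 0 b, InRegion K (x R s) (r R s) (θ R s)) :
    Descent k f R b (x R) (r R) (θ R) := by
  have hK : 0 ≤ K := hR.le.trans hRK
  refine ⟨hb, hR, F.x_zero R, F.r_zero R, F.θ_zero R, fun s hs => ?_,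
    fun s hs => F.r_pos R s hR hs.1, fun s hs => (h s hs).x_pos, fun s hs => (h s hs).θ_gt,
    fun s hs => (h s hs).θ_neg, fun s hs => (h s hs).radial_neg⟩
  refine F.system R s ?_ ?_ ?_
  · exact le_of_forall_mem_Ioo hb (F.continuous_x R).abs.continuousOn continuousOn_const
      (fun s hs => ((h s hs).abs_le hK).1) s hs
  · exact le_of_forall_mem_Ioo hb (F.continuous_r R).abs.continuousOn continuousOn_const
      (fun s hs => ((h s hs).abs_le hK).2.1) s hs
  · exact le_of_forall_mem_Ioo hb (F.continuous_θ R).abs.continuousOn continuousOn_const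
      (fun s hs => ((h s hs).abs_le hK).2.2) s hs

theorem ShootingFamily.eventually_inRegion_start {k : ℕ} {m M : ℝ} {f : ℝ → ℝ}
    (hf : ConvexWeight m M f) {K : ℝ} {x r θ : ℝ → ℝ → ℝ}
    (F : ShootingFamily k f K x r θ) {R₀ : ℝ} (hR₀ : 0 < R₀) (hK : R₀ < K)
    (hg : (k : ℝ) + 1 < R₀ ^ 2 * deriv f (R₀ ^ 2) / 2) :
    ∃ ε > 0, ∀ᶠ R in 𝓝 R₀, ∀ s ∈ Ioc 0 ε, InRegion K (x R s) (r R s) (θ R s) := by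
  have hx := F.x_cont
  have hr := F.r_cont
  have hθ := F.θ_cont
  have hd := hf.continuous_deriv
  have hc : Continuous fun p : ℝ × ℝ => deriv f (x p.1 p.2 ^ 2 + r p.1 p.2 ^ 2) :=
    hd.comp (by fun_prop)
  have e1 : ∀ᶠ p : ℝ × ℝ in 𝓝 (R₀, 0), 0 < r p.1 p.2 * Real.cos (θ p.1 p.2) :=
    (by fun_prop : Continuous fun p : ℝ × ℝ => r p.1 p.2 * Real.cos (θ p.1 p.2)).continuousAt
      |>.eventually_const_lt (by simp [F.r_zero, F.θ_zero, hR₀])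
  have e2 : ∀ᶠ p : ℝ × ℝ in 𝓝 (R₀, 0), ((k : ℝ) - r p.1 p.2 ^ 2 / 2 *
      deriv f (x p.1 p.2 ^ 2 + r p.1 p.2 ^ 2)) * Real.cos (θ p.1 p.2)
    + x p.1 p.2 * r p.1 p.2 / 2 * deriv f (x p.1 p.2 ^ 2 + r p.1 p.2 ^ 2)
      * Real.sin (θ p.1 p.2) < 0 :=
    (by fun_prop : Continuous fun p : ℝ × ℝ => ((k : ℝ) - r p.1 p.2 ^ 2 / 2 *
      deriv f (x p.1 p.2 ^ 2 + r p.1 p.2 ^ 2)) * Real.cos (θ p.1 p.2)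
    + x p.1 p.2 * r p.1 p.2 / 2 * deriv f (x p.1 p.2 ^ 2 + r p.1 p.2 ^ 2)
      * Real.sin (θ p.1 p.2)).continuousAt.eventually_lt_const
      (by simp [F.r_zero, F.θ_zero, F.x_zero]; linarith)
  have e3 : ∀ᶠ p : ℝ × ℝ in 𝓝 (R₀, 0), r p.1 p.2 + (r p.1 p.2 * Real.cos (θ p.1 p.2)
      - x p.1 p.2 * Real.sin (θ p.1 p.2)) * (((k : ℝ) - r p.1 p.2 ^ 2 / 2 *
      deriv f (x p.1 p.2 ^ 2 + r p.1 p.2 ^ 2)) * Real.cos (θ p.1 p.2)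
    + x p.1 p.2 * r p.1 p.2 / 2 * deriv f (x p.1 p.2 ^ 2 + r p.1 p.2 ^ 2)
      * Real.sin (θ p.1 p.2)) < 0 :=
    (by fun_prop : Continuous fun p : ℝ × ℝ => r p.1 p.2 + (r p.1 p.2 * Real.cos (θ p.1 p.2)
      - x p.1 p.2 * Real.sin (θ p.1 p.2)) * (((k : ℝ) - r p.1 p.2 ^ 2 / 2 *
      deriv f (x p.1 p.2 ^ 2 + r p.1 p.2 ^ 2)) * Real.cos (θ p.1 p.2)
    + x p.1 p.2 * r p.1 p.2 / 2 * deriv f (x p.1 p.2 ^ 2 + r p.1 p.2 ^ 2)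
      * Real.sin (θ p.1 p.2))).continuousAt.eventually_lt_const
      (by simp [F.r_zero, F.θ_zero, F.x_zero]; nlinarith)
  have e4 : ∀ᶠ p : ℝ × ℝ in 𝓝 (R₀, 0), -Real.pi < θ p.1 p.2 :=
    hθ.continuousAt.eventually_const_lt (by simp [F.θ_zero, Real.pi_pos])
  have e4' : ∀ᶠ p : ℝ × ℝ in 𝓝 (R₀, 0), θ p.1 p.2 < 4 :=
    hθ.continuousAt.eventually_lt_const (by simp [F.θ_zero])
  have e5 : ∀ᶠ p : ℝ × ℝ in 𝓝 (R₀, 0), x p.1 p.2 ^ 2 + r p.1 p.2 ^ 2 < K ^ 2 :=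
    (by fun_prop : Continuous fun p : ℝ × ℝ => x p.1 p.2 ^ 2 + r p.1 p.2 ^ 2).continuousAt
      |>.eventually_lt_const (by simp only [F.x_zero, F.r_zero]; nlinarith)
  have e6 : ∀ᶠ p : ℝ × ℝ in 𝓝 (R₀, 0), 0 < p.1 :=
    continuous_fst.continuousAt.eventually_const_lt hR₀
  have hall := e1.and (e2.and (e3.and (e4.and (e4'.and (e5.and e6)))))
  rw [nhds_prod_eq] at hall
  obtain ⟨pa, hpa, pb, hpb, hab⟩ := eventually_prod_iff.1 hall
  obtain ⟨δ, hδ, hball⟩ := Metric.eventually_nhds_iff.1 hpb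
  refine ⟨δ / 2, by positivity, ?_⟩
  filter_upwards [hpa] with R hR s hs
  have hu : ∀ u ∈ Icc 0 s, pb u := fun u hu => hball (by
    rw [Real.dist_eq, sub_zero, abs_of_nonneg hu.1]; linarith [hu.2, hs.2])
  have hsys : ∀ u ∈ Icc 0 s, ConformalSystem k f (x R) (r R) (θ R) u := by
    intro u hu'
    obtain ⟨-, -, -, h4, h4', h5, h6⟩ := hab hR (hu u hu')
    have hK0 : 0 ≤ K := hR₀.le.trans hK.le
    have := Real.pi_lt_four
    simp only at h4 h4' h5
    exact F.system R u (abs_le_of_sq_le_sq (by nlinarith [sq_nonneg (r R u)]) hK0)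
      (abs_le_of_sq_le_sq (by nlinarith [sq_nonneg (x R u)]) hK0)
      (abs_le.2 ⟨by linarith, by linarith⟩)
  obtain ⟨-, -, -, h4, -, h5, h6⟩ := hab hR (hu s ⟨hs.1.le, le_rfl⟩)
  refine ⟨?_, F.r_pos R s h6 hs.1.le, h4, ?_, ?_, h5⟩
  · have := image_lt_of_hasDerivAt_neg (g := fun s => -x R s) hs.1
      (fun u hu' => (hsys u hu').1.neg)
      (fun u hu' => by have := (hab hR (hu u ⟨hu'.1.le, hu'.2.le⟩)).1; simp only at this; linarith)
    simp only [F.x_zero] at this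
    linarith
  · have := image_lt_of_hasDerivAt_neg (g := θ R) hs.1
      (fun u hu' => (hsys u hu').2.2)
      (fun u hu' => (hab hR (hu u ⟨hu'.1.le, hu'.2.le⟩)).2.1)
    rwa [F.θ_zero] at this
  · have := image_lt_of_hasDerivAt_neg hs.1
      (fun u hu' => (hsys u hu').hasDerivAt_radial)
      (fun u hu' => (hab hR (hu u ⟨hu'.1.le, hu'.2.le⟩)).2.2.1)
    simpa [F.θ_zero, F.x_zero] using this

theorem ShootingFamily.eventually_inRegion {k : ℕ} {m M : ℝ} {f : ℝ → ℝ}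
    (hf : ConvexWeight m M f) {K : ℝ} {x r θ : ℝ → ℝ → ℝ}
    (F : ShootingFamily k f K x r θ) {R₀ : ℝ} (hR₀ : 0 < R₀) (hK : R₀ < K)
    (hg : (k : ℝ) + 1 < R₀ ^ 2 * deriv f (R₀ ^ 2) / 2) {b : ℝ}
    (h : ∀ s ∈ Ioc 0 b, InRegion K (x R₀ s) (r R₀ s) (θ R₀ s)) :
    ∀ᶠ R in 𝓝 R₀, ∀ s ∈ Ioc 0 b, InRegion K (x R s) (r R s) (θ R s) := by
  obtain ⟨ε, hε, h1⟩ := F.eventually_inRegion_start hf hR₀ hK hg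
  have hx := F.x_cont
  have hr := F.r_cont
  have hθ := F.θ_cont
  have h2 : ∀ᶠ R in 𝓝 R₀, ∀ s ∈ Icc ε b, InRegion K (x R s) (r R s) (θ R s) := by
    refine isCompact_Icc.eventually_forall_of_forall_eventually fun s hs => ?_
    have hc : Continuous fun p : ℝ × ℝ => (x p.1 p.2, r p.1 p.2, θ p.1 p.2) := by fun_prop
    exact (hc.continuousAt (x := (R₀, s))).eventually ((isOpen_inRegion K).mem_nhds
      (show InRegion K (x R₀ s) (r R₀ s) (θ R₀ s) from h s ⟨hε.trans_le hs.1, hs.2⟩))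
  filter_upwards [h1, h2] with R h1 h2 s hs
  rcases le_total s ε with hle | hle
  · exact h1 s ⟨hs.1, hle⟩
  · exact h2 s ⟨hle, hs.2⟩

/-- The radius of the round shrinking sphere. -/
theorem ConvexWeight.exists_sphere_radius {m M : ℝ} {f : ℝ → ℝ} (hf : ConvexWeight m M f)
    (k : ℕ) : ∃ R > 0, R ^ 2 * deriv f (R ^ 2) / 2 = (k : ℝ) + 1 := by
  have hd := hf.continuous_deriv
  have hc : Continuous fun a : ℝ => a * deriv f a / 2 := by fun_prop
  have hm := hf.pos
  set A := 2 * ((k : ℝ) + 1) / m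
  have hA : 0 ≤ A := by positivity
  have hAm : A * m = 2 * ((k : ℝ) + 1) := by simp only [A]; field_simp
  obtain ⟨a, ha, hav⟩ : ((k : ℝ) + 1) ∈ (fun a : ℝ => a * deriv f a / 2) '' Icc 0 A := by
    refine intermediate_value_Icc hA hc.continuousOn ⟨?_, ?_⟩
    · simp only [zero_mul, zero_div]; positivity
    · have := mul_le_mul_of_nonneg_left (hf.low A) hA
      linarith
  have ha0 : 0 < a := by
    rcases ha.1.eq_or_lt with h | h
    · rw [← h] at hav
      simp only [zero_mul, zero_div] at hav
      have : (0 : ℝ) ≤ k := k.cast_nonneg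
      linarith
    · exact h
  refine ⟨√a, Real.sqrt_pos.2 ha0, ?_⟩
  rw [Real.sq_sqrt ha0.le]
  exact hav

theorem ConvexWeight.lt_of_sphere_radius_lt {m M : ℝ} {f : ℝ → ℝ} (hf : ConvexWeight m M f)
    {k : ℕ} {R₁ R : ℝ} (h0 : 0 < R₁) (h : R₁ ^ 2 * deriv f (R₁ ^ 2) / 2 = (k : ℝ) + 1)
    (hR : R₁ < R) : (k : ℝ) + 1 < R ^ 2 * deriv f (R ^ 2) / 2 := by
  have := hf.mul_deriv_lt (sq_nonneg R₁) (by nlinarith : R₁ ^ 2 < R ^ 2)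
  linarith

namespace Descent

variable {k : ℕ} {m M : ℝ} {f : ℝ → ℝ} {R b : ℝ} {x r θ : ℝ → ℝ}

theorem weight_mul_cos_lt (hf : ConvexWeight m M f) (h : Descent k f R b x r θ) {s t : ℝ}
    (hs : 0 ≤ s) (hst : s < t) (ht : t ≤ b) :
    weight k f (x t) (r t) * Real.cos (θ t) < weight k f (x s) (r s) * Real.cos (θ s) :=
  image_lt_of_hasDerivAt_neg (g := fun s => weight k f (x s) (r s) * Real.cos (θ s)) hst
    (fun u hu => (h.system u ⟨hs.trans hu.1, hu.2.trans ht⟩).hasDerivAt_weight_mul_cos hf)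
    (fun u hu => by
      have hr := h.r_pos u ⟨by linarith [hu.1], by linarith [hu.2]⟩
      have hx := h.x_pos u ⟨by linarith [hu.1], by linarith [hu.2]⟩
      have hW := weight_pos k f (a := x u) hr
      have hF := hf.deriv_pos (x u ^ 2 + r u ^ 2)
      have := mul_pos (mul_pos hr (mul_pos hW hx)) hF
      linarith)

theorem cos_pos_of_lt (hf : ConvexWeight m M f) (h : Descent k f R b x r θ) {s t : ℝ}
    (hs : 0 ≤ s) (hst : s < t) (ht : t ≤ b) (hcos : 0 ≤ Real.cos (θ t)) : 0 < Real.cos (θ s) := by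
  have h1 := h.weight_mul_cos_lt hf hs hst ht
  have h2 := weight_pos k f (a := x t) (h.r_pos t ⟨by linarith, ht⟩)
  have h3 := weight_pos k f (a := x s) (h.r_pos s ⟨hs, by linarith⟩)
  exact pos_of_mul_pos_right ((mul_nonneg h2.le hcos).trans_lt h1) h3.le

theorem cos_neg_of_lt (hf : ConvexWeight m M f) (h : Descent k f R b x r θ) {s t : ℝ}
    (hs : 0 ≤ s) (hst : s < t) (ht : t ≤ b) (hcos : Real.cos (θ s) ≤ 0) : Real.cos (θ t) < 0 := by
  by_contra hc
  exact absurd (h.cos_pos_of_lt hf hs hst ht (not_lt.1 hc)) (not_lt.2 hcos)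

theorem x_lt_of_cos_nonneg (hf : ConvexWeight m M f) (h : Descent k f R b x r θ) {s t : ℝ}
    (hs : 0 ≤ s) (hst : s < t) (ht : t ≤ b) (hcos : 0 ≤ Real.cos (θ t)) : x s < x t := by
  have := image_lt_of_hasDerivAt_neg (g := fun s => -x s) hst
    (fun u hu => (h.system u ⟨hs.trans hu.1, hu.2.trans ht⟩).1.neg)
    (fun u hu => by
      have := mul_pos (h.r_pos u ⟨by linarith [hu.1], by linarith [hu.2]⟩)
        (h.cos_pos_of_lt hf (by linarith [hu.1]) hu.2 ht hcos)
      linarith)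
  linarith

theorem x_lt_of_cos_nonpos (hf : ConvexWeight m M f) (h : Descent k f R b x r θ) {s t : ℝ}
    (hs : 0 ≤ s) (hst : s < t) (ht : t ≤ b) (hcos : Real.cos (θ s) ≤ 0) : x t < x s :=
  image_lt_of_hasDerivAt_neg hst
    (fun u hu => (h.system u ⟨hs.trans hu.1, hu.2.trans ht⟩).1)
    (fun u hu => mul_neg_of_pos_of_neg (h.r_pos u ⟨by linarith [hu.1], by linarith [hu.2]⟩)
        (h.cos_neg_of_lt hf hs hu.1 (by linarith [hu.2]) hcos))

theorem cos_neg_of_x_eq_zero (hf : ConvexWeight m M f) (h : Descent k f R b x r θ)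
    (hx : x b = 0) : Real.cos (θ b) < 0 := by
  by_contra hc
  have := h.x_lt_of_cos_nonneg hf le_rfl h.end_pos le_rfl (not_lt.1 hc)
  rw [h.x_zero, hx] at this
  exact lt_irrefl _ this

theorem θ_lt_of_cos_neg (h : Descent k f R b x r θ) {s : ℝ} (hs : s ∈ Icc 0 b)
    (hcos : Real.cos (θ s) < 0) : θ s < -(Real.pi / 2) := by
  by_contra hc
  have := h.θ_nonpos s hs
  exact absurd (Real.cos_nonneg_of_neg_pi_div_two_le_of_le (not_lt.1 hc)
    (by linarith [Real.pi_pos])) (not_le.2 hcos)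

end Descent

/-- The curve shot from `(0, R)` returns to the `r`-axis inside the descending region, with an
angle strictly between `-π` and `-π/2`. -/
def ReturnsEarly (K : ℝ) (x r θ : ℝ → ℝ → ℝ) (R : ℝ) : Prop :=
  ∃ s₁ > 0, (∀ s ∈ Ioo 0 s₁, InRegion K (x R s) (r R s) (θ R s)) ∧ x R s₁ = 0 ∧
    -Real.pi < θ R s₁ ∧ θ R s₁ < -(Real.pi / 2)

namespace ShootingFamily

variable {k : ℕ} {m M : ℝ} {f : ℝ → ℝ} {K : ℝ} {x r θ : ℝ → ℝ → ℝ}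

theorem radial_neg_of_θ_lt {a b φ : ℝ} (ha : 0 ≤ a) (hb : 0 < b) (h1 : -Real.pi < φ)
    (h2 : φ < -(Real.pi / 2)) : a * Real.cos φ + b * Real.sin φ < 0 := by
  have hs := Real.sin_neg_of_neg_of_neg_pi_lt (by linarith [Real.pi_pos]) h1
  have hc : Real.cos φ < 0 := by
    rw [← Real.cos_neg]
    exact Real.cos_neg_of_pi_div_two_lt_of_lt (by linarith) (by linarith [Real.pi_pos])
  nlinarith [mul_nonneg ha (neg_nonneg.2 hc.le), mul_pos hb (neg_pos.2 hs)]

theorem eventually_returnsEarly (hf : ConvexWeight m M f) (F : ShootingFamily k f K x r θ)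
    {R₀ : ℝ} (hR₀ : 0 < R₀) (hK : R₀ < K) (hg : (k : ℝ) + 1 < R₀ ^ 2 * deriv f (R₀ ^ 2) / 2)
    (h : ReturnsEarly K x r θ R₀) : ∀ᶠ R in 𝓝 R₀, ReturnsEarly K x r θ R := by
  obtain ⟨s₁, hs₁, hin, hx1, hθ1, hθ2⟩ := h
  have D := F.descent hR₀ hK.le hs₁ hin
  have hmem : s₁ ∈ Icc 0 s₁ := ⟨hs₁.le, le_rfl⟩
  have hρ : x R₀ s₁ ^ 2 + r R₀ s₁ ^ 2 < K ^ 2 := (D.normSq_le hmem).trans_lt (by nlinarith)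
  have hcos := D.cos_neg_of_x_eq_zero hf hx1
  have hx := F.x_cont
  have hr := F.r_cont
  have hθ := F.θ_cont
  have cx := F.continuous_x R₀
  have cr := F.continuous_r R₀
  have cθ := F.continuous_θ R₀
  have e1 : ∀ᶠ s in 𝓝 s₁, -Real.pi < θ R₀ s ∧ θ R₀ s < -(Real.pi / 2) ∧
      x R₀ s ^ 2 + r R₀ s ^ 2 < K ^ 2 :=
    (cθ.continuousAt.eventually_const_lt hθ1).and ((cθ.continuousAt.eventually_lt_const hθ2).and
      ((by fun_prop : Continuous fun s => x R₀ s ^ 2 + r R₀ s ^ 2).continuousAt.eventually_lt_const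
        hρ))
  obtain ⟨δ, hδ, hball⟩ := Metric.eventually_nhds_iff.1 e1
  set η := min (δ / 2) (s₁ / 2) with hη
  have hη0 : 0 < η := by positivity
  have hηδ : η < δ := (min_le_left _ _).trans_lt (by linarith)
  have hηs : η < s₁ := (min_le_right _ _).trans_lt (by linarith)
  have hnear : ∀ s ∈ Icc (s₁ - η) (s₁ + η), -Real.pi < θ R₀ s ∧ θ R₀ s < -(Real.pi / 2) ∧
      x R₀ s ^ 2 + r R₀ s ^ 2 < K ^ 2 := fun s hs => hball (by
    rw [Real.dist_eq, abs_lt]; constructor <;> linarith [hs.1, hs.2])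
  have hsys : ∀ s ∈ Icc s₁ (s₁ + η), ConformalSystem k f (x R₀) (r R₀) (θ R₀) s := by
    intro s hs
    obtain ⟨h1, h2, h3⟩ := hnear s ⟨by linarith [hs.1], hs.2⟩
    have hK0 : 0 ≤ K := hR₀.le.trans hK.le
    have := Real.pi_lt_four
    exact F.system R₀ s (abs_le_of_sq_le_sq (by nlinarith [sq_nonneg (r R₀ s)]) hK0)
      (abs_le_of_sq_le_sq (by nlinarith [sq_nonneg (x R₀ s)]) hK0)
      (abs_le.2 ⟨by linarith, by linarith [Real.pi_pos]⟩)
  have hxneg : x R₀ (s₁ + η) < 0 := by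
    have := image_lt_of_hasDerivAt_neg (by linarith : s₁ < s₁ + η) (fun u hu => (hsys u hu).1)
      (fun u hu => by
        obtain ⟨h1, h2, h3⟩ := hnear u ⟨by linarith [hu.1], hu.2.le⟩
        refine mul_neg_of_pos_of_neg (F.r_pos R₀ u hR₀ (by linarith [hu.1])) ?_
        rw [← Real.cos_neg]
        exact Real.cos_neg_of_pi_div_two_lt_of_lt (by linarith) (by linarith [Real.pi_pos]))
    linarith
  have t1 := F.eventually_inRegion hf hR₀ hK hg (b := s₁ - η)
    (fun s hs => hin s ⟨hs.1, by linarith [hs.2]⟩)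
  have t2 : ∀ᶠ R in 𝓝 R₀, ∀ s ∈ Icc (s₁ - η) (s₁ + η), -Real.pi < θ R s ∧
      θ R s < -(Real.pi / 2) ∧ x R s ^ 2 + r R s ^ 2 < K ^ 2 := by
    refine isCompact_Icc.eventually_forall_of_forall_eventually fun s hs => ?_
    obtain ⟨h1, h2, h3⟩ := hnear s hs
    exact ((hθ.continuousAt (x := (R₀, s))).eventually_const_lt h1).and
      (((hθ.continuousAt (x := (R₀, s))).eventually_lt_const h2).and
      ((by fun_prop : Continuous fun p : ℝ × ℝ => x p.1 p.2 ^ 2 + r p.1 p.2 ^ 2).continuousAt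
        (x := (R₀, s)) |>.eventually_lt_const h3))
  have t3 : ∀ᶠ R in 𝓝 R₀, x R (s₁ + η) < 0 :=
    (by fun_prop : Continuous fun R => x R (s₁ + η)).continuousAt.eventually_lt_const hxneg
  filter_upwards [t1, t2, t3, lt_mem_nhds hR₀] with R u1 u2 u3 hR
  have cxR := F.continuous_x R
  have hrR : ∀ s, 0 ≤ s → 0 < r R s := fun s hs => F.r_pos R s hR hs
  set S : Set ℝ := Icc (s₁ - η) (s₁ + η) ∩ x R ⁻¹' Iic 0
  have hSc : IsClosed S := isClosed_Icc.inter (isClosed_Iic.preimage cxR)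
  have hSne : S.Nonempty := ⟨s₁ + η, ⟨by linarith, le_rfl⟩, u3.le⟩
  have hSb : BddBelow S := ⟨s₁ - η, fun s hs => hs.1.1⟩
  have hSm := hSc.csInf_mem hSne hSb
  have hpos : ∀ s, 0 < s → s < sInf S → 0 < x R s := by
    intro s hs hlt
    rcases le_total s (s₁ - η) with hle | hle
    · exact (u1 s ⟨hs, hle⟩).x_pos
    · by_contra hc
      exact absurd (csInf_le hSb ⟨⟨hle, hlt.le.trans hSm.1.2⟩, not_lt.1 hc⟩) (not_le.2 hlt)
  have hS0 : 0 < sInf S := by linarith [hSm.1.1]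
  have hx0 : x R (sInf S) = 0 := by
    refine le_antisymm hSm.2 ?_
    exact le_of_forall_mem_Ioo hS0 continuousOn_const cxR.continuousOn
      (fun s hs => (hpos s hs.1 hs.2).le) _ ⟨hS0.le, le_rfl⟩
  refine ⟨sInf S, hS0, fun s hs => ?_, hx0, (u2 _ hSm.1).1, (u2 _ hSm.1).2.1⟩
  rcases le_total s (s₁ - η) with hle | hle
  · exact u1 s ⟨hs.1, hle⟩
  · obtain ⟨h1, h2, h3⟩ := u2 s ⟨hle, hs.2.le.trans hSm.1.2⟩
    have hxp := hpos s hs.1 hs.2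
    exact ⟨hxp, hrR s hs.1.le, h1, by linarith [Real.pi_pos],
      radial_neg_of_θ_lt hxp.le (hrR s hs.1.le) h1 h2, h3⟩

theorem eventually_not_returnsEarly_of_exit (hf : ConvexWeight m M f)
    (F : ShootingFamily k f K x r θ)
    {R₀ : ℝ} (hR₀ : 0 < R₀) (hK : R₀ < K) (hg : (k : ℝ) + 1 < R₀ ^ 2 * deriv f (R₀ ^ 2) / 2)
    {s₁ : ℝ} (hs₁ : 0 < s₁) (hin : ∀ s ∈ Ioo 0 s₁, InRegion K (x R₀ s) (r R₀ s) (θ R₀ s))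
    (hx1 : 0 < x R₀ s₁)
    (hbad : ∀ δ > 0, ∃ s ∈ Ioo s₁ (s₁ + δ), θ R₀ s < -Real.pi ∨
      0 < x R₀ s * Real.cos (θ R₀ s) + r R₀ s * Real.sin (θ R₀ s)) :
    ∀ᶠ R in 𝓝 R₀, ¬ ReturnsEarly K x r θ R := by
  have hx := F.x_cont
  have hr := F.r_cont
  have hθ := F.θ_cont
  obtain ⟨δ, hδ, hball⟩ := Metric.eventually_nhds_iff.1
    ((F.continuous_x R₀).continuousAt.eventually_const_lt hx1)
  set η := min (δ / 2) (s₁ / 2) with hη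
  have hη0 : 0 < η := by positivity
  have hηδ : η < δ := (min_le_left _ _).trans_lt (by linarith)
  have hηs : η < s₁ := (min_le_right _ _).trans_lt (by linarith)
  obtain ⟨s₂, hs₂, hout⟩ := hbad η hη0
  have t1 := F.eventually_inRegion hf hR₀ hK hg (b := s₁ - η)
    (fun s hs => hin s ⟨hs.1, by linarith [hs.2]⟩)
  have t2 : ∀ᶠ R in 𝓝 R₀, ∀ s ∈ Icc (s₁ - η) s₂, 0 < x R s := by
    refine isCompact_Icc.eventually_forall_of_forall_eventually fun s hs => ?_
    exact (hx.continuousAt (x := (R₀, s))).eventually_const_lt (hball (by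
      rw [Real.dist_eq, abs_lt]; constructor <;> linarith [hs.1, hs.2, hs₂.2]))
  have t3 : ∀ᶠ R in 𝓝 R₀, θ R s₂ < -Real.pi ∨
      0 < x R s₂ * Real.cos (θ R s₂) + r R s₂ * Real.sin (θ R s₂) := by
    rcases hout with h | h
    · filter_upwards [(by fun_prop : Continuous fun R => θ R s₂).continuousAt.eventually_lt_const h]
        with R h using Or.inl h
    · filter_upwards [(by fun_prop : Continuous fun R => x R s₂ * Real.cos (θ R s₂) +
        r R s₂ * Real.sin (θ R s₂)).continuousAt.eventually_const_lt h] with R h using Or.inr h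
  filter_upwards [t1, t2, t3] with R u1 u2 u3
  rintro ⟨sA, hsA, hinA, hxA, -, -⟩
  have hlt : s₂ < sA := by
    by_contra hle
    push Not at hle
    rcases le_total sA (s₁ - η) with h | h
    · exact (u1 sA ⟨hsA, h⟩).x_pos.ne' hxA
    · exact (u2 sA ⟨h, hle⟩).ne' hxA
  have := hinA s₂ ⟨by linarith [hs₂.1], hlt⟩
  rcases u3 with h | h
  · linarith [this.θ_gt]
  · linarith [this.radial_neg]

/-- Curves which come close to the axis of rotation away from the origin with positive horizontal
speed do not return early. -/
theorem eventually_not_returnsEarly_of_axis (hf : ConvexWeight m M f) (hk : 1 ≤ k)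
    (F : ShootingFamily k f K x r θ) {R₀ : ℝ} (hR₀ : 0 < R₀) (hK : R₀ < K) {a : ℝ} (ha : 0 < a)
    (h : ∀ ε > 0, ∃ s > 0, (∀ u ∈ Icc 0 s, 0 < Real.cos (θ R₀ u)) ∧ r R₀ s < ε ∧ a < x R₀ s) :
    ∀ᶠ R in 𝓝 R₀, ¬ ReturnsEarly K x r θ R := by
  have hx := F.x_cont
  have hr := F.r_cont
  have hθ := F.θ_cont
  have hM : 0 < M := hf.pos.trans_le ((hf.low 0).trans (hf.up 0))
  have hk' : (1 : ℝ) ≤ k := by exact_mod_cast hk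
  have hπ := Real.pi_pos
  set κ := Real.pi / a with hκ
  have hκ0 : 0 < κ := by positivity
  have hκa : κ * a = Real.pi := by rw [hκ]; field_simp
  set ε := min 1 (1 / (κ + M / 2)) with hε
  have hε0 : 0 < ε := by positivity
  have hε1 : ε ≤ 1 := min_le_left _ _
  have hε2 : ε * (κ + M / 2) ≤ 1 := by
    calc ε * (κ + M / 2) ≤ 1 / (κ + M / 2) * (κ + M / 2) := by
          gcongr
          exact min_le_right _ _
      _ = 1 := by field_simp
  obtain ⟨s₂, hs₂, hcos, hrε, hxa⟩ := h ε hε0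
  have t1 : ∀ᶠ R in 𝓝 R₀, ∀ s ∈ Icc 0 s₂, 0 < Real.cos (θ R s) := by
    refine isCompact_Icc.eventually_forall_of_forall_eventually fun s hs => ?_
    exact ((by fun_prop : Continuous fun p : ℝ × ℝ => Real.cos (θ p.1 p.2)).continuousAt
      (x := (R₀, s))).eventually_const_lt (hcos s hs)
  have t2 : ∀ᶠ R in 𝓝 R₀, r R s₂ < ε :=
    (by fun_prop : Continuous fun R => r R s₂).continuousAt.eventually_lt_const hrε
  have t3 : ∀ᶠ R in 𝓝 R₀, a < x R s₂ :=
    (by fun_prop : Continuous fun R => x R s₂).continuousAt.eventually_const_lt hxa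
  filter_upwards [t1, t2, t3, lt_mem_nhds hR₀, gt_mem_nhds hK] with R u1 u2 u3 hR hRK
  rintro ⟨sA, hsA, hinA, hxA, hθA, hθA'⟩
  have D := F.descent hR hRK.le hsA hinA
  have hcA := D.cos_neg_of_x_eq_zero hf hxA
  have hlt : s₂ < sA := by
    by_contra hle
    exact absurd (u1 sA ⟨hsA.le, not_lt.1 hle⟩) (not_lt.2 hcA.le)
  obtain ⟨c, hc, hc0⟩ : (0 : ℝ) ∈ (fun s => Real.cos (θ R s)) '' Icc s₂ sA :=
    intermediate_value_Icc' hlt.le (by have := F.continuous_θ R; fun_prop)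
      ⟨hcA.le, (u1 s₂ ⟨hs₂.le, le_rfl⟩).le⟩
  simp only at hc0
  have hcs : s₂ < c := by
    rcases hc.1.eq_or_lt with h | h
    · have := u1 s₂ ⟨hs₂.le, le_rfl⟩
      rw [h, hc0] at this
      exact absurd this (lt_irrefl _)
    · exact h
  have hxc := D.x_lt_of_cos_nonneg hf hs₂.le hcs hc.2 hc0.ge
  have key := image_le_of_hasDerivAt_nonpos (g := fun s => θ R s - κ * x R s) hc.2
    (fun u hu => (D.system u ⟨by linarith [hu.1], hu.2⟩).2.2.sub
      ((D.system u ⟨by linarith [hu.1], hu.2⟩).1.const_mul κ)) ?_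
  · simp only [hxA] at key
    have h1 := D.θ_nonpos c ⟨by linarith, hc.2⟩
    nlinarith
  · intro u hu
    have hu' : u ∈ Ioo 0 sA := ⟨by linarith [hu.1], hu.2⟩
    have hu'' := Ioo_subset_Icc_self hu'
    have hr0 := D.r_pos u hu''
    have hrlt : r R u < ε := (D.r_le hs₂.le (by linarith [hu.1]) hu.2.le).trans_lt u2
    have hcu := D.cos_neg_of_lt hf (by linarith) hu.1 hu.2.le hc0.le
    have hsu := D.sin_neg u hu'
    have hxu := D.x_pos u hu'
    have hFu := hf.up (x R u ^ 2 + r R u ^ 2)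
    have hF0 := hf.deriv_pos (x R u ^ 2 + r R u ^ 2)
    set Fu := deriv f (x R u ^ 2 + r R u ^ 2)
    have h1 : x R u * r R u / 2 * Fu * Real.sin (θ R u) ≤ 0 :=
      mul_nonpos_of_nonneg_of_nonpos (by positivity) hsu.le
    have h2 : κ * r R u ≤ k - r R u ^ 2 / 2 * Fu := by
      have : r R u ^ 2 / 2 * Fu ≤ ε / 2 * M := by
        gcongr
        nlinarith
      nlinarith
    nlinarith [mul_nonneg (sub_nonneg.2 h2) (neg_nonneg.2 hcu.le)]

end ShootingFamily

theorem exists_pos_of_hasDerivAt_pos {g : ℝ → ℝ} {g' a : ℝ} (h : HasDerivAt g g' a)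
    (h0 : g a = 0) (hg' : 0 < g') : ∀ δ > 0, ∃ s ∈ Ioo a (a + δ), 0 < g s := by
  intro δ hδ
  have h1 := (hasDerivAt_iff_tendsto_slope.1 h).eventually_const_lt hg'
  have h2 : ∀ᶠ s in 𝓝[>] a, 0 < slope g a s :=
    h1.filter_mono (nhdsWithin_mono a fun s hs => ne_of_gt hs)
  have h3 : ∀ᶠ s in 𝓝[>] a, s ∈ Ioo a (a + δ) := Ioo_mem_nhdsGT (by linarith)
  obtain ⟨s, hs, hmem⟩ := (h2.and h3).exists
  refine ⟨s, hmem, ?_⟩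
  rw [slope_def_field, h0, sub_zero] at hs
  exact (div_pos_iff_of_pos_right (by linarith [hmem.1])).1 hs

theorem ConvexWeight.exp_neg_le {m M : ℝ} {f : ℝ → ℝ} (hf : ConvexWeight m M f) {a b : ℝ}
    (h : a ≤ b) : Real.exp (-f b / 4) ≤ Real.exp (-f a / 4) :=
  Real.exp_le_exp.2 (by linarith [hf.monotone h])

namespace Descent

variable {k : ℕ} {m M : ℝ} {f : ℝ → ℝ} {R b : ℝ} {x r θ : ℝ → ℝ}

theorem r_le_radius (h : Descent k f R b x r θ) {s : ℝ} (hs : s ∈ Icc 0 b) : r s ≤ R := by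
  have := h.r_le le_rfl hs.1 hs.2
  rwa [h.r_zero] at this

/-- If the position vector becomes orthogonal to the normal direction, the curve is inside the
shrinking sphere. -/
theorem normSq_mul_deriv_lt (hf : ConvexWeight m M f) (h : Descent k f R b x r θ)
    (hT : x b * Real.cos (θ b) + r b * Real.sin (θ b) = 0) :
    (x b ^ 2 + r b ^ 2) * deriv f (x b ^ 2 + r b ^ 2) / 2 < k + 1 := by
  by_contra hc
  push Not at hc
  have := image_lt_of_hasDerivAt_neg
    (g := fun s => weight k f (x s) (r s) * (x s * Real.cos (θ s) + r s * Real.sin (θ s)))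
    h.end_pos (fun u hu => (h.system u hu).hasDerivAt_weight_mul_radial hf) (fun u hu => by
      have h1 := hf.mul_deriv_lt (by positivity) (h.normSq_lt hu.1.le hu.2 le_rfl)
      have hr := h.r_pos u (Ioo_subset_Icc_self hu)
      have hW := weight_pos k f (a := x u) hr
      exact mul_neg_of_pos_of_neg hW (mul_neg_of_pos_of_neg hr (by linarith)))
  simp [hT, h.x_zero, h.θ_zero] at this

/-- At a point where the curve turns by a full half circle away from the `r`-axis, it turns
transversally. -/
theorem deriv_θ_of_eq_neg_pi (hf : ConvexWeight m M f) (h : Descent k f R b x r θ)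
    (hθ : θ b = -Real.pi) : r b ^ 2 / 2 * deriv f (x b ^ 2 + r b ^ 2) < k := by
  by_contra hc
  push Not at hc
  have hM : 0 < M := hf.pos.trans_le ((hf.low 0).trans (hf.up 0))
  have hmem : b ∈ Icc 0 b := ⟨h.end_pos.le, le_rfl⟩
  have hcb : Real.cos (θ b) < 0 := by rw [hθ]; simp
  have hcont := (h.system b hmem).2.2.continuousAt
  have hev : ∀ᶠ s in 𝓝[<] b, Real.cos (θ s) < 0 :=
    (((Real.continuous_cos.continuousAt.comp hcont)).eventually_lt_const hcb).filter_mono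
      nhdsWithin_le_nhds
  have hev2 : ∀ᶠ s in 𝓝[<] b, s ∈ Ioo 0 b := Ioo_mem_nhdsLT h.end_pos
  obtain ⟨c, hc1, hc2⟩ := (hev.and hev2).exists
  set C := R ^ 2 * M with hC
  have key := image_le_of_hasDerivAt_nonpos
    (g := fun s => -((θ s + Real.pi) * Real.exp (C * s))) hc2.2.le
    (fun u hu => ((((h.system u ⟨hc2.1.le.trans hu.1, hu.2⟩).2.2.add_const Real.pi).mul
      ((hasDerivAt_id u).const_mul C).exp).neg)) ?_
  · simp only [hθ] at key
    have h1 := h.θ_gt c hc2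
    have h2 := mul_pos (by linarith : 0 < θ c + Real.pi) (Real.exp_pos (C * c))
    simp at key
    linarith
  · intro u hu
    have hu' : u ∈ Ioo 0 b := ⟨hc2.1.trans hu.1, hu.2⟩
    have hu'' := Ioo_subset_Icc_self hu'
    have hcu := h.cos_neg_of_lt hf hc2.1.le hu.1 hu.2.le hc1.le
    have hr := h.r_pos u hu''
    have hrb := h.r_pos b hmem
    have hx := h.x_pos u hu'
    have hθu := h.θ_gt u hu'
    have hρ := h.normSq_lt hu'.1.le hu.2 le_rfl
    have hF := hf.mono hρ.le
    have hFb := hf.deriv_pos (x b ^ 2 + r b ^ 2)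
    have hFu := hf.up (x u ^ 2 + r u ^ 2)
    have hF0 := hf.deriv_pos (x u ^ 2 + r u ^ 2)
    set Fu := deriv f (x u ^ 2 + r u ^ 2)
    have hrr := h.r_lt hu'.1.le hu.2 le_rfl
    have hh : (k : ℝ) ≤ r u ^ 2 / 2 * Fu :=
      hc.trans (mul_le_mul (by nlinarith) hF hFb.le (by positivity))
    have hsin : -(θ u + Real.pi) ≤ Real.sin (θ u) := by
      have := Real.sin_le (by linarith : 0 ≤ θ u + Real.pi)
      rw [Real.sin_add_pi] at this
      linarith
    have hxr : x u * r u / 2 * Fu ≤ C := by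
      have := h.normSq_le hu''
      rw [hC]
      exact mul_le_mul (by nlinarith [sq_nonneg (x u - r u)]) hFu hF0.le (sq_nonneg R)
    have hpos : 0 ≤ x u * r u / 2 * Fu := by positivity
    have h1 : -(C * (θ u + Real.pi)) ≤ x u * r u / 2 * Fu * Real.sin (θ u) := by
      nlinarith
    have h2 : 0 ≤ (k - r u ^ 2 / 2 * Fu) * Real.cos (θ u) := by nlinarith
    have he := Real.exp_pos (C * u)
    have := mul_nonneg he.le (by linarith : 0 ≤ ((k - r u ^ 2 / 2 * Fu) * Real.cos (θ u) +
      x u * r u / 2 * Fu * Real.sin (θ u)) + C * (θ u + Real.pi))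
    simp only [id]
    nlinarith

/-- A curve which descends forever moves to the right forever. -/
theorem cos_pos_of_forever (hf : ConvexWeight m M f) (hk : 1 ≤ k)
    (h : ∀ b > 0, Descent k f R b x r θ) {s : ℝ} (hs : 0 ≤ s) : 0 < Real.cos (θ s) := by
  by_contra hc
  push Not at hc
  have hR := (h 1 one_pos).radius_pos
  have hneg := (h (s + 1) (by linarith)).cos_neg_of_lt hf hs (by linarith) le_rfl hc
  set s' := s + 1 with hs'
  have hr' := (h s' (by linarith)).r_pos s' ⟨by linarith, le_rfl⟩
  set j := -(weight k f (x s') (r s') * Real.cos (θ s')) with hj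
  have hj0 : 0 < j := by
    have := mul_pos (weight_pos k f (a := x s') hr') (neg_pos.2 hneg)
    linarith
  set C := R ^ (k - 1) * Real.exp (-f 0 / 4) with hCd
  have hC : 0 < C := by positivity
  set T := C / j * (x s' + 1) with hT
  have hx' := (h s' (by linarith)).x_nonneg s' ⟨by linarith, le_rfl⟩
  have hT0 : 0 < T := by positivity
  have D := h (s' + T) (by linarith)
  have key := image_le_of_hasDerivAt_nonpos (g := fun u => x u + j / C * u)
    (by linarith : s' ≤ s' + T) (fun u hu => ((D.system u ⟨by linarith [hu.1], hu.2⟩).1.add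
      ((hasDerivAt_id u).const_mul (j / C)))) (fun u hu => by
      have hmem : u ∈ Icc 0 (s' + T) := ⟨by linarith [hu.1], hu.2.le⟩
      have hJ := D.weight_mul_cos_lt hf (by linarith) hu.1 hu.2.le
      have hr := D.r_pos u hmem
      have hW := weight_pos k f (a := x u) hr
      have hWC : weight k f (x u) (r u) ≤ r u * C := by
        have e : r u ^ k = r u * r u ^ (k - 1) := by
          rw [← pow_succ']; congr 1; omega
        rw [weight, e, hCd, ← mul_assoc]
        have := D.r_le_radius hmem
        exact mul_le_mul (by gcongr) (hf.exp_neg_le (by positivity)) (by positivity)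
          (by positivity)
      have h1 : weight k f (x u) (r u) * Real.cos (θ u) ≤ -j := by linarith
      have hcu : Real.cos (θ u) < 0 := by
        by_contra hcu
        have := mul_nonneg hW.le (not_lt.1 hcu)
        linarith
      have h2 : r u * C * Real.cos (θ u) ≤ -j := by nlinarith
      have h3 : r u * Real.cos (θ u) ≤ -j / C := by
        rw [le_div_iff₀ hC]; linarith
      have e : -j / C = -(j / C) := by ring
      simp only [mul_one]
      linarith)
  have hx := D.x_nonneg (s' + T) ⟨by linarith, le_rfl⟩
  have e : j / C * T = x s' + 1 := by rw [hT]; field_simp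
  simp only [mul_add] at key
  linarith

theorem exists_r_lt_of_forever (hf : ConvexWeight m M f) (hk : 1 ≤ k)
    (h : ∀ b > 0, Descent k f R b x r θ) {ε : ℝ} (hε : 0 < ε) : ∃ s > 1, r s < ε := by
  by_contra! hc
  have hx1 : 0 < x 1 := (h 2 two_pos).x_pos 1 ⟨one_pos, by norm_num⟩
  set c := min (x 1) ε / 2 with hcd
  have hc0 : 0 < c := by positivity
  have hR := (h 1 one_pos).radius_pos
  set T := R / c with hT
  have hT0 : 0 < T := by positivity
  have D := h (2 + T) (by linarith)
  have key := image_le_of_hasDerivAt_nonpos (g := fun u => r u + c * u)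
    (by linarith : 2 ≤ 2 + T) (fun u hu => ((D.system u ⟨by linarith [hu.1], hu.2⟩).2.1.add
      ((hasDerivAt_id u).const_mul c))) (fun u hu => by
      have hmem : u ∈ Ioo 0 (2 + T) := ⟨by linarith [hu.1], hu.2⟩
      have hcos := cos_pos_of_forever hf hk h hmem.1.le
      have hxu := D.x_lt_of_cos_nonneg hf zero_le_one (by linarith [hu.1]) hu.2.le hcos.le
      have hru := hc u (by linarith [hu.1])
      have hT' := D.radial_neg u hmem
      have hsin := D.sin_neg u hmem
      have hsc := Real.sin_sq_add_cos_sq (θ u)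
      have hm1 : min (x 1) ε ≤ x u := (min_le_left _ _).trans hxu.le
      have hm2 : min (x 1) ε ≤ r u := (min_le_right _ _).trans hru
      have hm0 : 0 < min (x 1) ε := lt_min hx1 hε
      have h1 : 1 ≤ Real.cos (θ u) - Real.sin (θ u) := by
        nlinarith [mul_pos hcos (neg_pos.2 hsin)]
      have h2 : min (x 1) ε * Real.cos (θ u) ≤ x u * Real.cos (θ u) := by gcongr
      have h3 : min (x 1) ε * (-Real.sin (θ u)) ≤ r u * (-Real.sin (θ u)) :=
        mul_le_mul_of_nonneg_right hm2 (by linarith)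
      have h4 : min (x 1) ε * 1 ≤ min (x 1) ε * (Real.cos (θ u) - Real.sin (θ u)) := by gcongr
      simp only [hcd]
      nlinarith)
  have h2 := D.r_le_radius (s := 2) ⟨by norm_num, by linarith⟩
  have h3 := D.r_pos (2 + T) ⟨by linarith, le_rfl⟩
  have e : c * T = R := by rw [hT]; field_simp
  simp only [mul_add] at key
  linarith

end Descent

/-- A threshold curve for early returns closes up perfectly. -/
theorem ShootingFamily.exists_perfect_return {k : ℕ} {m M : ℝ} {f : ℝ → ℝ} {K : ℝ}
    {x r θ : ℝ → ℝ → ℝ} (hf : ConvexWeight m M f) (hk : 1 ≤ k)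
    (F : ShootingFamily k f K x r θ) {R₀ : ℝ} (hR₀ : 0 < R₀) (hK : R₀ < K)
    (hg : (k : ℝ) + 1 < R₀ ^ 2 * deriv f (R₀ ^ 2) / 2)
    (hA : ¬ ReturnsEarly K x r θ R₀) (hfreq : ∃ᶠ R in 𝓝 R₀, ReturnsEarly K x r θ R) :
    ∃ s₁, Descent k f R₀ s₁ (x R₀) (r R₀) (θ R₀) ∧ x R₀ s₁ = 0 ∧ θ R₀ s₁ = -Real.pi := by
  obtain ⟨ε, hε, hstart⟩ := F.eventually_inRegion_start hf hR₀ hK hg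
  have cx := F.continuous_x R₀
  have cr := F.continuous_r R₀
  have cθ := F.continuous_θ R₀
  rcases forall_mem_or_exists_first_exit (isOpen_inRegion K)
    (by fun_prop : Continuous fun s => (x R₀ s, r R₀ s, θ R₀ s)) hε hstart.self_of_nhds with
    hall | ⟨s₁, hs₁, hin, hout⟩
  · exfalso
    have D : ∀ b > 0, Descent k f R₀ b (x R₀) (r R₀) (θ R₀) :=
      fun b hb => F.descent hR₀ hK.le hb fun s hs => hall s hs.1
    refine hfreq (F.eventually_not_returnsEarly_of_axis hf hk hR₀ hK (hall 1 one_pos).x_pos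
      fun η hη => ?_)
    obtain ⟨s, hs, hrs⟩ := Descent.exists_r_lt_of_forever hf hk D hη
    exact ⟨s, by linarith, fun u hu => Descent.cos_pos_of_forever hf hk D hu.1, hrs,
      (D s (by linarith)).x_lt_of_cos_nonneg hf zero_le_one hs le_rfl
        (Descent.cos_pos_of_forever hf hk D (by linarith)).le⟩
  · have D := F.descent hR₀ hK.le hs₁ hin
    have hmem : s₁ ∈ Icc 0 s₁ := ⟨hs₁.le, le_rfl⟩
    refine ⟨s₁, D, ?_⟩
    have hθ0 := D.θ_nonpos s₁ hmem
    have hθπ := D.θ_ge s₁ hmem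
    have hT := D.radial_nonpos s₁ hmem
    have hr := D.r_pos s₁ hmem
    rcases (D.x_nonneg s₁ hmem).eq_or_lt with hx | hx
    · refine ⟨hx.symm, ?_⟩
      by_contra hne
      exact hA ⟨s₁, hs₁, hin, hx.symm, lt_of_le_of_ne hθπ (Ne.symm hne),
        D.θ_lt_of_cos_neg hmem (D.cos_neg_of_x_eq_zero hf hx.symm)⟩
    · exfalso
      refine hfreq (F.eventually_not_returnsEarly_of_exit hf hR₀ hK hg hs₁ hin hx ?_)
      rcases hθπ.eq_or_lt with hθ | hθ
      · have h1 := D.deriv_θ_of_eq_neg_pi hf hθ.symm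
        intro δ hδ
        obtain ⟨s, hs, hpos⟩ := exists_pos_of_hasDerivAt_pos
          (((D.system s₁ hmem).2.2.add_const Real.pi).neg) (by simp [← hθ])
          (by simp [← hθ]; linarith) δ hδ
        simp only [Pi.neg_apply] at hpos
        exact ⟨s, hs, Or.inl (by linarith)⟩
      · have hT0 : x R₀ s₁ * Real.cos (θ R₀ s₁) + r R₀ s₁ * Real.sin (θ R₀ s₁) = 0 := by
          by_contra hne
          refine hout ⟨hx, hr, hθ, lt_of_le_of_ne hθ0 ?_, lt_of_le_of_ne hT hne,
            (D.normSq_le hmem).trans_lt (by nlinarith)⟩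
          intro h0
          rw [show θ R₀ s₁ = 0 from h0] at hT
          simp at hT
          linarith
        have h1 := D.normSq_mul_deriv_lt hf hT0
        have hW := weight_pos k f (a := x R₀ s₁) hr
        intro δ hδ
        obtain ⟨s, hs, hpos⟩ := exists_pos_of_hasDerivAt_pos
          ((D.system s₁ hmem).hasDerivAt_weight_mul_radial hf) (by simp [hT0])
          (mul_pos hW (mul_pos hr (by linarith))) δ hδ
        refine ⟨s, hs, Or.inr ?_⟩
        exact pos_of_mul_pos_right hpos
          (weight_pos k f (F.r_pos R₀ s hR₀ (by linarith [hs.1]))).le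

theorem cos_neg_arctan_sinh (s : ℝ) : Real.cos (-Real.arctan (Real.sinh s)) = 1 / Real.cosh s := by
  rw [Real.cos_neg, Real.cos_arctan, add_comm, ← Real.cosh_sq, Real.sqrt_sq (Real.cosh_pos s).le]

theorem sin_neg_arctan_sinh (s : ℝ) :
    Real.sin (-Real.arctan (Real.sinh s)) = -(Real.sinh s / Real.cosh s) := by
  rw [Real.sin_neg, Real.sin_arctan, add_comm, ← Real.cosh_sq, Real.sqrt_sq (Real.cosh_pos s).le]

/-- The profile curve of the round shrinking sphere. -/
theorem conformalSystem_sphere {k : ℕ} {f : ℝ → ℝ} {R : ℝ}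
    (hR : R ^ 2 * deriv f (R ^ 2) / 2 = (k : ℝ) + 1) (s : ℝ) :
    ConformalSystem k f (fun s => R * (Real.sinh s / Real.cosh s)) (fun s => R / Real.cosh s)
      (fun s => -Real.arctan (Real.sinh s)) s := by
  have hc := (Real.cosh_pos s).ne'
  have hcs := Real.cosh_sq s
  have e : (R * (Real.sinh s / Real.cosh s)) ^ 2 + (R / Real.cosh s) ^ 2 = R ^ 2 := by
    field_simp
    rw [hcs]
  refine ⟨?_, ?_, ?_⟩
  · refine (((Real.hasDerivAt_sinh s).div (Real.hasDerivAt_cosh s) hc).const_mul R).congr_deriv ?_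
    rw [cos_neg_arctan_sinh]
    field_simp
    rw [hcs]
    ring
  · refine ((hasDerivAt_const s R).div (Real.hasDerivAt_cosh s) hc).congr_deriv ?_
    rw [sin_neg_arctan_sinh]
    field_simp
    ring
  · refine (Real.hasDerivAt_sinh s).arctan.neg.congr_deriv ?_
    rw [cos_neg_arctan_sinh, sin_neg_arctan_sinh, e]
    have h1 : 1 + Real.sinh s ^ 2 = Real.cosh s ^ 2 := by rw [hcs]; ring
    rw [h1]
    field_simp
    have h2 : R ^ 2 * deriv f (R ^ 2) = 2 * (k + 1) := by linarith
    linear_combination (Real.sinh s ^ 2 + 1) * h2 + (-2 * (k : ℝ) - 2) * hcs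

theorem ShootingFamily.eventually_not_returnsEarly_of_sphere {k : ℕ} {m M : ℝ} {f : ℝ → ℝ}
    {K : ℝ} {x r θ : ℝ → ℝ → ℝ} (hf : ConvexWeight m M f) (hk : 1 ≤ k)
    (F : ShootingFamily k f K x r θ) {R₀ : ℝ} (hR₀ : 0 < R₀) (hK : R₀ < K)
    (hR : R₀ ^ 2 * deriv f (R₀ ^ 2) / 2 = (k : ℝ) + 1) :
    ∀ᶠ R in 𝓝 R₀, ¬ ReturnsEarly K x r θ R := by
  have hu := F.unique R₀ (fun s => R₀ * (Real.sinh s / Real.cosh s)) (fun s => R₀ / Real.cosh s)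
    (fun s => -Real.arctan (Real.sinh s)) (by simp) (by simp) (by simp) fun s => by
      have hc := Real.one_le_cosh s
      have hlt : |Real.sinh s| ≤ Real.cosh s :=
        abs_le_of_sq_le_sq (by rw [Real.cosh_sq]; linarith) (Real.cosh_pos s).le
      refine ⟨?_, ?_, ?_, conformalSystem_sphere hR s⟩
      · simp only [abs_mul, abs_div, abs_of_pos hR₀, abs_of_pos (Real.cosh_pos s)]
        have := (div_le_one (Real.cosh_pos s)).2 hlt
        nlinarith
      · simp only [abs_div, abs_of_pos hR₀, abs_of_pos (Real.cosh_pos s)]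
        exact (div_le_self hR₀.le hc).trans hK.le
      · have := Real.arctan_lt_pi_div_two (Real.sinh s)
        have := Real.neg_pi_div_two_lt_arctan (Real.sinh s)
        have := Real.pi_lt_four
        exact abs_le.2 ⟨by linarith, by linarith⟩
  refine F.eventually_not_returnsEarly_of_axis hf hk hR₀ hK (half_pos hR₀) fun ε hε => ?_
  set s := 2 * (2 + R₀ / ε) with hs
  have hq : 0 < R₀ / ε := by positivity
  have hcosh : 2 + R₀ / ε < Real.cosh s := by
    rw [Real.cosh_eq]
    have := Real.add_one_le_exp s
    have := Real.exp_pos (-s)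
    linarith
  have hc0 := Real.cosh_pos s
  refine ⟨s, by positivity, fun u _ => ?_, ?_, ?_⟩
  · rw [(hu u).2.2, cos_neg_arctan_sinh]
    have := Real.cosh_pos u
    positivity
  · rw [(hu s).2.1, div_lt_iff₀ hc0]
    have h1 : R₀ / ε < Real.cosh s := by linarith
    rw [div_lt_iff₀ hε] at h1
    linarith
  · rw [(hu s).1]
    have h1 : Real.cosh s - Real.sinh s ≤ 1 := by
      rw [Real.cosh_sub_sinh]
      exact Real.exp_le_one_iff.2 (by simp only [hs]; linarith)
    have h2 : 1 / 2 < Real.sinh s / Real.cosh s := by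
      rw [lt_div_iff₀ hc0]
      linarith
    nlinarith

/-- Quantitative largeness of the initial height. -/
structure LargeRadius (k : ℕ) (m M R : ℝ) : Prop where
  eight_le : 8 ≤ R
  mul_nat_le : 16 * (k : ℝ) ≤ R ^ 2 * m
  one_le : 1 ≤ M * R
  pi_le : 8 * Real.pi ≤ R * m
  pow_lt : 512 * M * 2 ^ k < m ^ 2 * R

theorem eventually_largeRadius (k : ℕ) {m M : ℝ} (hm : 0 < m) (hM : 0 < M) :
    ∀ᶠ R in atTop, LargeRadius k m M R := by
  have e1 := eventually_ge_atTop (8 : ℝ)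
  have e2 := eventually_ge_atTop (16 * (k : ℝ) / m)
  have e3 := eventually_ge_atTop (1 / M)
  have e4 := eventually_ge_atTop (8 * Real.pi / m)
  have e5 := eventually_gt_atTop (512 * M * 2 ^ k / m ^ 2)
  filter_upwards [e1, e2, e3, e4, e5] with R h1 h2 h3 h4 h5
  rw [div_le_iff₀ hm] at h2 h4
  rw [div_le_iff₀ hM] at h3
  rw [div_lt_iff₀ (by positivity)] at h5
  refine ⟨h1, ?_, by linarith, h4, by linarith⟩
  nlinarith [mul_pos (by linarith : 0 < R) hm]

namespace ConformalSystem

variable {k : ℕ} {f : ℝ → ℝ} {x r θ : ℝ → ℝ} {s : ℝ}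

theorem hasDerivAt_div (h : ConformalSystem k f x r θ s) (hr : r s ≠ 0) :
    HasDerivAt (fun s => x s / r s)
      ((r s * Real.cos (θ s) - x s * Real.sin (θ s)) / r s) s := by
  refine (h.1.div h.2.1 hr).congr_deriv ?_
  field_simp

end ConformalSystem

namespace Descent

variable {k : ℕ} {m M : ℝ} {f : ℝ → ℝ} {R b : ℝ} {x r θ : ℝ → ℝ}

theorem weight_mul_support_lt (hf : ConvexWeight m M f) (hk : 1 ≤ k) (h : Descent k f R b x r θ)
    {s t : ℝ} (hs : 0 ≤ s) (hst : s < t) (ht : t ≤ b) :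
    weight k f (x t) (r t) * (r t * Real.cos (θ t) - x t * Real.sin (θ t)) <
      weight k f (x s) (r s) * (r s * Real.cos (θ s) - x s * Real.sin (θ s)) :=
  image_lt_of_hasDerivAt_neg (g := fun s => weight k f (x s) (r s) *
      (r s * Real.cos (θ s) - x s * Real.sin (θ s))) hst
    (fun u hu => (h.system u ⟨hs.trans hu.1, hu.2.trans ht⟩).hasDerivAt_weight_mul_support hf)
    (fun u hu => by
      have hr := h.r_pos u ⟨by linarith [hu.1], by linarith [hu.2]⟩
      have hx := h.x_pos u ⟨by linarith [hu.1], by linarith [hu.2]⟩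
      have hW := weight_pos k f (a := x u) hr
      have hk' : (1 : ℝ) ≤ k := by exact_mod_cast hk
      have := mul_pos (by linarith : (0 : ℝ) < k) (mul_pos hW hx)
      linarith)

theorem support_neg_of_lt (hf : ConvexWeight m M f) (hk : 1 ≤ k) (h : Descent k f R b x r θ)
    {s t : ℝ} (hs : 0 ≤ s) (hst : s < t) (ht : t ≤ b)
    (hN : r s * Real.cos (θ s) - x s * Real.sin (θ s) ≤ 0) :
    r t * Real.cos (θ t) - x t * Real.sin (θ t) < 0 := by
  have h1 := h.weight_mul_support_lt hf hk hs hst ht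
  have h2 := weight_pos k f (a := x t) (h.r_pos t ⟨by linarith, ht⟩)
  have h3 := weight_pos k f (a := x s) (h.r_pos s ⟨hs, by linarith⟩)
  exact neg_of_mul_neg_right (h1.trans_le (mul_nonpos_of_nonneg_of_nonpos h3.le hN)) h2.le

theorem exists_cos_eq_zero (h : Descent k f R b x r θ) {s : ℝ} (hs : s ∈ Icc 0 b)
    (hcos : Real.cos (θ s) < 0) : ∃ c ∈ Ioo 0 s, Real.cos (θ c) = 0 := by
  have hc := (Real.continuous_cos.comp_continuousOn h.θ_cont).mono (Icc_subset_Icc le_rfl hs.2)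
  obtain ⟨c, hc, hc0⟩ : (0 : ℝ) ∈ (fun s => Real.cos (θ s)) '' Icc 0 s :=
    intermediate_value_Icc' hs.1 hc ⟨hcos.le, by simp [h.θ_zero]⟩
  simp only at hc0
  refine ⟨c, ⟨lt_of_le_of_ne hc.1 ?_, lt_of_le_of_ne hc.2 ?_⟩, hc0⟩
  · rintro rfl
    simp [h.θ_zero] at hc0
  · rintro rfl
    exact hcos.ne hc0

/-- High above the axis the curve cannot move far to the right. -/
theorem x_le_of_half_le (hf : ConvexWeight m M f) (hR : LargeRadius k m M R)
    (h : Descent k f R b x r θ) {s : ℝ} (hs : s ∈ Icc 0 b) (hr : R / 2 ≤ r s) :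
    x s ≤ 8 * Real.pi / (R * m) := by
  have hm := hf.pos
  have hRpos := h.radius_pos
  have main : ∀ s ∈ Icc 0 b, R / 2 ≤ r s → 0 ≤ Real.cos (θ s) →
      x s ≤ 8 * Real.pi / (R * m) := by
    intro s hs hr hcos
    have key := image_le_of_hasDerivAt_nonpos (g := fun u => θ u + R * m / 8 * x u) hs.1
      (fun u hu => (h.system u ⟨hu.1, hu.2.trans hs.2⟩).2.2.add
        ((h.system u ⟨hu.1, hu.2.trans hs.2⟩).1.const_mul (R * m / 8))) (fun u hu => by
        have hu' : u ∈ Ioo 0 b := ⟨hu.1, hu.2.trans_le hs.2⟩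
        have hru : R / 2 ≤ r u := hr.trans (h.r_le hu.1.le hu.2.le hs.2)
        have hr0 := h.r_pos u (Ioo_subset_Icc_self hu')
        have hx := h.x_pos u hu'
        have hsin := h.sin_neg u hu'
        have hcu := h.cos_pos_of_lt hf hu.1.le hu.2 hs.2 hcos
        have hF := hf.low (x u ^ 2 + r u ^ 2)
        have hF0 := hf.deriv_pos (x u ^ 2 + r u ^ 2)
        set Fu := deriv f (x u ^ 2 + r u ^ 2)
        have h1 : x u * r u / 2 * Fu * Real.sin (θ u) ≤ 0 :=
          mul_nonpos_of_nonneg_of_nonpos (by positivity) hsin.le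
        have h2 : r u * (R / 2) * m ≤ r u ^ 2 * Fu := by
          rw [sq]
          gcongr
        have h3 : (R / 2) * (R / 2) * m ≤ r u * (R / 2) * m := by gcongr
        have h4 := hR.mul_nat_le
        have h5 : (k - r u ^ 2 / 2 * Fu) + R * m / 8 * r u ≤ 0 := by nlinarith
        nlinarith [mul_nonneg hcu.le (neg_nonneg.2 h5)])
    simp only [h.θ_zero, h.x_zero] at key
    have h1 := h.θ_ge s hs
    rw [le_div_iff₀ (by positivity)]
    linarith
  rcases le_or_gt 0 (Real.cos (θ s)) with hc | hc
  · exact main s hs hr hc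
  · obtain ⟨c, hcs, hc0⟩ := h.exists_cos_eq_zero hs hc
    have hcb : c ∈ Icc 0 b := ⟨hcs.1.le, hcs.2.le.trans hs.2⟩
    exact (h.x_lt_of_cos_nonpos hf hcs.1.le hcs.2 hs.2 hc0.le).le.trans
      (main c hcb (hr.trans (h.r_le hcs.1.le hcs.2.le hs.2)) hc0.ge)

/-- The curve stays almost horizontal for a short time. -/
theorem r_ge_of_le (h : Descent k f R b x r θ) {s : ℝ} (hs : s ∈ Icc 0 b) : R - R * s ≤ r s := by
  have key := image_le_of_hasDerivAt_nonpos (g := fun u => -(r u + R * u)) hs.1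
    (fun u hu => ((h.system u ⟨hu.1, hu.2.trans hs.2⟩).2.1.add
      ((hasDerivAt_id u).const_mul R)).neg) (fun u hu => by
      have hu' : u ∈ Icc 0 b := ⟨hu.1.le, hu.2.le.trans hs.2⟩
      have := h.r_le_radius hu'
      have := h.r_pos u hu'
      nlinarith [Real.neg_one_le_sin (θ u)])
  simp only [h.r_zero] at key
  linarith

theorem θ_ge_of_largeRadius (hf : ConvexWeight m M f) (hR : LargeRadius k m M R)
    (h : Descent k f R b x r θ) {s : ℝ} (hs : s ∈ Icc 0 b) : -(M * R ^ 2 * s) ≤ θ s := by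
  have key := image_le_of_hasDerivAt_nonpos (g := fun u => -(θ u + M * R ^ 2 * u)) hs.1
    (fun u hu => ((h.system u ⟨hu.1, hu.2.trans hs.2⟩).2.2.add
      ((hasDerivAt_id u).const_mul (M * R ^ 2))).neg) (fun u hu => by
      have hu' : u ∈ Ioo 0 b := ⟨hu.1, hu.2.trans_le hs.2⟩
      have hr0 := h.r_pos u (Ioo_subset_Icc_self hu')
      have hx := h.x_pos u hu'
      have hF := hf.low (x u ^ 2 + r u ^ 2)
      have hFM := hf.up (x u ^ 2 + r u ^ 2)
      have hF0 := hf.deriv_pos (x u ^ 2 + r u ^ 2)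
      set Fu := deriv f (x u ^ 2 + r u ^ 2)
      have hρ := h.normSq_le (Ioo_subset_Icc_self hu')
      have hk0 : (0 : ℝ) ≤ k := k.cast_nonneg
      have hkM : 16 * (k : ℝ) ≤ R ^ 2 * M :=
        hR.mul_nat_le.trans (by gcongr; exact hF.trans hFM)
      have h1 : r u ^ 2 / 2 * Fu ≤ R ^ 2 / 2 * M :=
        mul_le_mul (by nlinarith) hFM hF0.le (by positivity)
      have h2 : x u * r u / 2 * Fu ≤ R ^ 2 / 4 * M :=
        mul_le_mul (by nlinarith [sq_nonneg (x u - r u)]) hFM hF0.le (by positivity)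
      have h1' : 0 ≤ r u ^ 2 / 2 * Fu := by positivity
      have h2' : 0 ≤ x u * r u / 2 * Fu := by positivity
      have hc := Real.abs_cos_le_one (θ u)
      have hsn := Real.neg_one_le_sin (θ u)
      have h3 : -(x u * r u / 2 * Fu) ≤ x u * r u / 2 * Fu * Real.sin (θ u) := by nlinarith
      have h4 : -(k + r u ^ 2 / 2 * Fu) ≤ (k - r u ^ 2 / 2 * Fu) * Real.cos (θ u) := by
        have h5 : |(k - r u ^ 2 / 2 * Fu) * Real.cos (θ u)| ≤ k + r u ^ 2 / 2 * Fu := by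
          rw [abs_mul]
          have h6 : |(k : ℝ) - r u ^ 2 / 2 * Fu| ≤ k + r u ^ 2 / 2 * Fu :=
            abs_le.2 ⟨by linarith, by linarith⟩
          exact (mul_le_of_le_one_right (abs_nonneg _) hc).trans h6
        exact (abs_le.1 h5).1
      simp only [mul_one]
      linarith)
  simp only [h.θ_zero] at key
  linarith

theorem weight_mul_support_add_le (hf : ConvexWeight m M f) (hk : 1 ≤ k)
    (h : Descent k f R b x r θ) {a c q : ℝ} (ha : 0 ≤ a) (hac : a ≤ c) (hc : c ≤ b) (hq : 0 ≤ q)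
    (hqx : ∀ u ∈ Ioo a c, q * r u ≤ weight k f (x u) (r u) * x u) :
    weight k f (x c) (r c) * (r c * Real.cos (θ c) - x c * Real.sin (θ c)) + q * (r a - r c) ≤
      weight k f (x a) (r a) * (r a * Real.cos (θ a) - x a * Real.sin (θ a)) := by
  have hk' : (1 : ℝ) ≤ k := by exact_mod_cast hk
  have key := image_le_of_hasDerivAt_nonpos (g := fun u => weight k f (x u) (r u) *
      (r u * Real.cos (θ u) - x u * Real.sin (θ u)) - q * r u) hac
    (fun u hu => ((h.system u ⟨ha.trans hu.1, hu.2.trans hc⟩).hasDerivAt_weight_mul_support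
      hf).sub ((h.system u ⟨ha.trans hu.1, hu.2.trans hc⟩).2.1.const_mul q))
    (fun u hu => by
      have hr0 := h.r_pos u ⟨ha.trans hu.1.le, hu.2.le.trans hc⟩
      have h1 := hqx u hu
      have h2 : 0 ≤ q * r u := by positivity
      have h3 := Real.neg_one_le_sin (θ u)
      have h4 : weight k f (x u) (r u) * x u ≤ k * (weight k f (x u) (r u) * x u) :=
        le_mul_of_one_le_left (h2.trans h1) hk'
      nlinarith)
  linarith

theorem x_ge_of_largeRadius (hf : ConvexWeight m M f) (hR : LargeRadius k m M R)
    (h : Descent k f R b x r θ) {e : ℝ} (he0 : 0 < e) (heb : e ≤ b) (hRe : R * e ≤ 1)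
    (hMe : M * R ^ 2 * e = 1) : R / 4 * e ≤ x e := by
  have hR8 := hR.eight_le
  have hM : 0 < M := hf.pos.trans_le ((hf.low 0).trans (hf.up 0))
  have key := image_le_of_hasDerivAt_nonpos (g := fun u => R / 4 * u - x u) he0.le
    (fun u hu => ((hasDerivAt_id u).const_mul (R / 4)).sub
      (h.system u ⟨hu.1, hu.2.trans heb⟩).1) (fun u hu => by
      have hu' : u ∈ Icc 0 b := ⟨hu.1.le, hu.2.le.trans heb⟩
      have h1 := h.r_ge_of_le hu'
      have h2 := h.θ_ge_of_largeRadius hf hR hu'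
      have h3 := h.θ_nonpos u hu'
      have h4 := Real.one_sub_sq_div_two_le_cos (x := θ u)
      have h5 : M * R ^ 2 * u ≤ M * R ^ 2 * e := by gcongr; exact hu.2.le
      have h6 : 1 / 2 ≤ Real.cos (θ u) := by nlinarith
      have h7 : R * u ≤ R * e := mul_le_mul_of_nonneg_left hu.2.le h.radius_pos.le
      have h8 : R / 2 ≤ r u := by linarith
      have h9 : R / 2 * (1 / 2) ≤ r u * Real.cos (θ u) :=
        mul_le_mul h8 h6 (by norm_num) (h.r_pos u hu').le
      simp only [mul_one]
      linarith)
  simp only [h.x_zero] at key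
  linarith

theorem div_le_div_of_support_nonneg (h : Descent k f R b x r θ) {a c : ℝ} (ha : 0 ≤ a)
    (hac : a ≤ c) (hc : c ≤ b)
    (hN : ∀ v ∈ Ioo a c, 0 ≤ r v * Real.cos (θ v) - x v * Real.sin (θ v)) :
    x a / r a ≤ x c / r c := by
  have key := image_le_of_hasDerivAt_nonpos (g := fun u => -(x u / r u)) hac
    (fun v hv => ((h.system v ⟨ha.trans hv.1, hv.2.trans hc⟩).hasDerivAt_div
      (h.r_pos v ⟨ha.trans hv.1, hv.2.trans hc⟩).ne').neg) (fun v hv => by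
      have := div_nonneg (hN v hv) (h.r_pos v ⟨ha.trans hv.1.le, hv.2.le.trans hc⟩).le
      linarith)
  linarith

end Descent

theorem ConvexWeight.pow_mul_exp_lt {k : ℕ} {m M R e : ℝ} {f : ℝ → ℝ} (hf : ConvexWeight m M f)
    (hR : LargeRadius k m M R) (he0 : 0 < e) (hMe : M * R ^ 2 * e = 1) :
    R ^ k * Real.exp (-f (R ^ 2) / 4) * R <
      (R / 2) ^ k * Real.exp (-f ((R / 2 + 1) ^ 2 + 1) / 4) * (e / 4) := by
  have hm := hf.pos
  have hM : 0 < M := hm.trans_le ((hf.low 0).trans (hf.up 0))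
  have hR8 := hR.eight_le
  have hR0 : 0 < R := by linarith
  obtain ⟨y, hy⟩ : ∃ y, y = m * R ^ 2 / 8 := ⟨_, rfl⟩
  have hy0 : 0 ≤ y := by rw [hy]; positivity
  have hgap := hf.add_mul_sub_le (a := (R / 2 + 1) ^ 2 + 1) (b := R ^ 2) (by nlinarith)
  have hexp : Real.exp (-f (R ^ 2) / 4) * Real.exp y ≤
      Real.exp (-f ((R / 2 + 1) ^ 2 + 1) / 4) := by
    rw [← Real.exp_add]
    refine Real.exp_le_exp.2 ?_
    have : 0 ≤ m * (R ^ 2 / 4 - R - 2) := mul_nonneg hm.le (by nlinarith)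
    rw [hy]
    linarith
  have hquad := Real.quadratic_le_exp_of_nonneg hy0
  have hR3 : 0 < R ^ 3 := by positivity
  have hpow : 512 * M * 2 ^ k * R ^ 3 < m ^ 2 * R * R ^ 3 :=
    mul_lt_mul_of_pos_right hR.pow_lt hR3
  have hy2 : 2 ^ k * R * (4 * (M * R ^ 2)) < Real.exp y := by
    have : y ^ 2 / 2 = m ^ 2 * R * R ^ 3 / 128 := by rw [hy]; ring
    linarith
  have h1 : 2 ^ k * R < Real.exp y * (e / 4) := by
    have h2 := mul_lt_mul_of_pos_right hy2 (by positivity : 0 < e / 4)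
    have h3 : 2 ^ k * R * (4 * (M * R ^ 2)) * (e / 4) = 2 ^ k * R := by
      linear_combination (2 ^ k * R) * hMe
    linarith
  have hE := Real.exp_pos (-f (R ^ 2) / 4)
  calc R ^ k * Real.exp (-f (R ^ 2) / 4) * R
      = (R / 2) ^ k * Real.exp (-f (R ^ 2) / 4) * (2 ^ k * R) := by
        rw [div_pow]; field_simp
    _ < (R / 2) ^ k * Real.exp (-f (R ^ 2) / 4) * (Real.exp y * (e / 4)) := by gcongr
    _ = (R / 2) ^ k * (Real.exp (-f (R ^ 2) / 4) * Real.exp y) * (e / 4) := by ring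
    _ ≤ _ := by gcongr

namespace Descent

variable {k : ℕ} {m M : ℝ} {f : ℝ → ℝ} {R b : ℝ} {x r θ : ℝ → ℝ}

/-- Below half the initial height of a very high curve, the support function is negative. -/
theorem support_neg (hf : ConvexWeight m M f) (hk : 1 ≤ k) (hR : LargeRadius k m M R)
    (h : Descent k f R b x r θ) (hrb : r b ≤ R / 2) :
    r b * Real.cos (θ b) - x b * Real.sin (θ b) < 0 := by
  by_contra hN
  push Not at hN
  have hm := hf.pos
  have hM : 0 < M := hf.pos.trans_le ((hf.low 0).trans (hf.up 0))
  have hRpos := h.radius_pos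
  have hR8 := hR.eight_le
  have hb := h.end_pos
  obtain ⟨e, he⟩ : ∃ e, e = 1 / (M * R ^ 2) := ⟨_, rfl⟩
  have he0 : 0 < e := by rw [he]; positivity
  have hRe : R * e ≤ 1 := by
    have h0 : R * e * (M * R) = 1 := by rw [he]; field_simp
    have h1 := hR.one_le
    have : 0 ≤ R * e := by positivity
    nlinarith
  have hMe : M * R ^ 2 * e = 1 := by rw [he]; field_simp
  have heb : e < b := by
    by_contra hle
    have h1 := h.r_ge_of_le (s := b) ⟨hb.le, le_rfl⟩
    have h2 : R * b ≤ R * e := mul_le_mul_of_nonneg_left (not_lt.1 hle) hRpos.le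
    linarith
  have hNpos : ∀ s ∈ Icc 0 b, 0 ≤ r s * Real.cos (θ s) - x s * Real.sin (θ s) := by
    intro s hs
    rcases hs.2.eq_or_lt with rfl | hlt
    · exact hN
    · by_contra hneg
      exact absurd hN (not_le.2 (h.support_neg_of_lt hf hk hs.1 hlt le_rfl (not_le.1 hneg).le))
  have hxe := h.x_ge_of_largeRadius hf hR he0 heb.le hRe hMe
  have hdiv : ∀ u ∈ Icc e b, e / 4 * r u ≤ x u := by
    intro u hu
    have hre := h.r_pos e ⟨he0.le, heb.le⟩
    have hru := h.r_pos u ⟨he0.le.trans hu.1, hu.2⟩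
    have key := h.div_le_div_of_support_nonneg he0.le hu.1 hu.2
      (fun v hv => hNpos v ⟨he0.le.trans hv.1.le, hv.2.le.trans hu.2⟩)
    have h1 : e / 4 ≤ x e / r e := by
      rw [le_div_iff₀ hre]
      have := mul_le_mul_of_nonneg_left (h.r_le_radius (s := e) ⟨he0.le, heb.le⟩)
        (by positivity : 0 ≤ e / 4)
      linarith
    exact (le_div_iff₀ hru).1 (h1.trans key)
  have hre := h.r_ge_of_le (s := e) ⟨he0.le, heb.le⟩
  obtain ⟨a, ha, hra⟩ : (R / 2 + 1) ∈ r '' Icc e b :=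
    intermediate_value_Icc' heb.le (h.r_cont.mono (Icc_subset_Icc he0.le le_rfl))
      ⟨by linarith, by linarith⟩
  have ha0 : 0 ≤ a := he0.le.trans ha.1
  obtain ⟨c, hc, hrc⟩ : R / 2 ∈ r '' Icc a b :=
    intermediate_value_Icc' ha.2 (h.r_cont.mono (Icc_subset_Icc ha0 le_rfl))
      ⟨hrb, by linarith⟩
  obtain ⟨w, hw⟩ : ∃ w, w = (R / 2) ^ k * Real.exp (-f ((R / 2 + 1) ^ 2 + 1) / 4) := ⟨_, rfl⟩
  have hw0 : 0 < w := by rw [hw]; positivity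
  have key := h.weight_mul_support_add_le hf hk ha0 hc.1 hc.2
    (by positivity : 0 ≤ w * (e / 4)) (fun u hu => by
      have hu' : u ∈ Icc 0 b := ⟨ha0.trans hu.1.le, hu.2.le.trans hc.2⟩
      have hru : R / 2 ≤ r u := hrc ▸ h.r_le hu'.1 hu.2.le hc.2
      have hru2 : r u ≤ R / 2 + 1 := hra ▸ h.r_le ha0 hu.1.le hu'.2
      have hr0 := h.r_pos u hu'
      have hxu := hdiv u ⟨ha.1.trans hu.1.le, hu'.2⟩
      have hx1 : x u ≤ 1 := (h.x_le_of_half_le hf hR hu' hru).trans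
        ((div_le_one (by positivity)).2 hR.pi_le)
      have hx0 := h.x_nonneg u hu'
      have hWw : w ≤ weight k f (x u) (r u) := by
        rw [hw, weight]
        refine mul_le_mul (pow_le_pow_left₀ (by positivity) hru k)
          (hf.exp_neg_le ?_) (Real.exp_pos _).le (by positivity)
        have e1 : x u ^ 2 ≤ 1 := pow_le_one₀ hx0 hx1
        have e2 : r u ^ 2 ≤ (R / 2 + 1) ^ 2 := pow_le_pow_left₀ hr0.le hru2 2
        linarith
      rw [mul_assoc]
      exact mul_le_mul hWw hxu (by positivity) (hw0.le.trans hWw))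
  have hWN0 : weight k f (x a) (r a) * (r a * Real.cos (θ a) - x a * Real.sin (θ a)) ≤
      R ^ k * Real.exp (-f (R ^ 2) / 4) * R := by
    have := (h.weight_mul_support_lt hf hk le_rfl (he0.trans_le ha.1) ha.2).le
    simpa [h.x_zero, h.r_zero, h.θ_zero, weight] using this
  have hfin : 0 ≤ weight k f (x c) (r c) * (r c * Real.cos (θ c) - x c * Real.sin (θ c)) :=
    mul_nonneg (weight_pos k f (h.r_pos c ⟨ha0.trans hc.1, hc.2⟩)).le
      (hNpos c ⟨ha0.trans hc.1, hc.2⟩)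
  have hlt := hf.pow_mul_exp_lt hR he0 hMe
  rw [← hw] at hlt
  rw [show r a - r c = 1 by rw [hra, hrc]; ring, mul_one] at key
  linarith

end Descent

theorem le_image_of_forall_lt_imp_hasDerivAt_nonneg {g g' : ℝ → ℝ} {a b c : ℝ} (hab : a ≤ b)
    (hg : ∀ s ∈ Icc a b, HasDerivAt g (g' s) s) (ha : c ≤ g a)
    (h : ∀ s ∈ Ioo a b, g s < c → 0 ≤ g' s) : c ≤ g b := by
  have hcont : ContinuousOn g (Icc a b) := fun s hs => (hg s hs).continuousAt.continuousWithinAt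
  have hcpt : IsCompact (Icc a b ∩ g ⁻¹' Ici c) :=
    isCompact_Icc.of_isClosed_subset (hcont.preimage_isClosed_of_isClosed isClosed_Icc isClosed_Ici)
      inter_subset_left
  obtain ⟨s, ⟨hs, hsc⟩, hmax⟩ := hcpt.exists_isGreatest ⟨a, left_mem_Icc.2 hab, ha⟩
  have key := image_le_of_hasDerivAt_nonpos (g := fun u => -g u) hs.2
    (fun u hu => (hg u ⟨hs.1.trans hu.1, hu.2⟩).neg) (fun u hu => by
      have hu' : u ∈ Ioo a b := ⟨hs.1.trans_lt hu.1, hu.2⟩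
      have := h u hu' (by
        by_contra hc
        exact absurd (hmax ⟨Ioo_subset_Icc_self hu', not_lt.1 hc⟩) (not_le.2 hu.1))
      linarith)
  have : c ≤ g s := hsc
  linarith

theorem exists_first_hit {g : ℝ → ℝ} {a b v : ℝ} (hab : a ≤ b) (hg : ContinuousOn g (Icc a b))
    (ha : v ≤ g a) (hb : g b ≤ v) : ∃ c ∈ Icc a b, g c = v ∧ ∀ u ∈ Icc a c, v ≤ g u := by
  have hcpt : IsCompact (Icc a b ∩ g ⁻¹' Iic v) :=
    isCompact_Icc.of_isClosed_subset (hg.preimage_isClosed_of_isClosed isClosed_Icc isClosed_Iic)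
      inter_subset_left
  obtain ⟨c, ⟨hc, hcv⟩, hmin⟩ := hcpt.exists_isLeast ⟨b, right_mem_Icc.2 hab, hb⟩
  obtain ⟨d, hd, hdv⟩ := intermediate_value_Icc' hc.1 (hg.mono (Icc_subset_Icc le_rfl hc.2))
    ⟨hcv, ha⟩
  have hdc : d = c := le_antisymm hd.2 (hmin ⟨⟨hd.1, hd.2.trans hc.2⟩, hdv.le⟩)
  rw [hdc] at hdv
  refine ⟨c, hc, hdv, fun u hu => ?_⟩
  by_contra hlt
  have : u = c := le_antisymm hu.2 (hmin ⟨⟨hu.1, hu.2.trans hc.2⟩, (not_le.1 hlt).le⟩)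
  rw [this, hdv] at hlt
  exact hlt le_rfl

namespace Descent

variable {k : ℕ} {m M : ℝ} {f : ℝ → ℝ} {R b : ℝ} {x r θ : ℝ → ℝ}

/-- A narrow curve stays almost vertical after its vertical point, as long as it is high. -/
theorem neg_le_cos (hf : ConvexWeight m M f) (h : Descent k f R b x r θ) {c X p s : ℝ}
    (hc : 0 < c) (hcm : 4 * (k : ℝ) ≤ c ^ 2 * m) (hX : 0 ≤ X) (hx : ∀ u ∈ Icc 0 b, x u ≤ X)
    (hp : 0 ≤ p) (hps : p ≤ s) (hs : s ≤ b) (hcos : Real.cos (θ p) = 0) (hr : c ≤ r s) :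
    -(4 * X / c) ≤ Real.cos (θ s) := by
  have hη : 0 ≤ 4 * X / c := by positivity
  refine le_image_of_forall_lt_imp_hasDerivAt_nonneg (g := fun u => Real.cos (θ u)) hps
    (fun u hu => (h.system u ⟨hp.trans hu.1, hu.2.trans hs⟩).2.2.cos) (by simp [hcos, hη])
    (fun u hu hlt => ?_)
  have hu' : u ∈ Ioo 0 b := ⟨hp.trans_lt hu.1, hu.2.trans_le hs⟩
  have hu'' := Ioo_subset_Icc_self hu'
  have hru : c ≤ r u := hr.trans (h.r_le hu'.1.le hu.2.le hs)
  have hxu := hx u hu''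
  have hx0 := h.x_pos u hu'
  have hsin := h.sin_neg u hu'
  have hs1 := Real.neg_one_le_sin (θ u)
  have hF := hf.low (x u ^ 2 + r u ^ 2)
  have hF0 := hf.deriv_pos (x u ^ 2 + r u ^ 2)
  obtain ⟨F, hFe⟩ : ∃ F, F = deriv f (x u ^ 2 + r u ^ 2) := ⟨_, rfl⟩
  rw [← hFe] at hF hF0 ⊢
  obtain ⟨η, hηe⟩ : ∃ η, η = 4 * X / c := ⟨_, rfl⟩
  rw [← hηe] at hη hlt
  have hcη : c * η = 4 * X := by rw [hηe]; field_simp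
  have h1 : c ^ 2 * m ≤ r u ^ 2 * F :=
    mul_le_mul (pow_le_pow_left₀ hc.le hru 2) hF hf.pos.le (by positivity)
  have h2 : r u ^ 2 * F / 4 * η ≤ (k - r u ^ 2 / 2 * F) * Real.cos (θ u) := by
    have h3 : 0 ≤ r u ^ 2 * F / 4 := by positivity
    have h4 : r u ^ 2 * F / 4 ≤ r u ^ 2 / 2 * F - k := by linarith
    have h5 : η ≤ -Real.cos (θ u) := by linarith
    have := mul_le_mul h4 h5 hη (h3.trans h4)
    linarith
  have h6 : -(X * r u * F / 2) ≤ x u * r u / 2 * F * Real.sin (θ u) := by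
    have h7 : 0 ≤ r u * F / 2 := by have := hc.trans_le hru; positivity
    have h8 : x u * -Real.sin (θ u) ≤ X * 1 := mul_le_mul hxu (by linarith) (by linarith) hX
    have := mul_le_mul_of_nonneg_left h8 h7
    linarith
  have h9 : X * r u * F / 2 ≤ r u ^ 2 * F / 4 * η := by
    have h10 : c * η ≤ r u * η := mul_le_mul_of_nonneg_right hru hη
    have h7 : 0 ≤ r u * F / 4 := by have := hc.trans_le hru; positivity
    have := mul_le_mul_of_nonneg_left (by linarith : 2 * X ≤ r u * η) h7
    linarith
  exact mul_nonneg (by linarith) (by linarith)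

/-- The support function of a descending curve prevents it from coming close to the axis. -/
theorem le_r_of_support_neg (hf : ConvexWeight m M f) (hk : 1 ≤ k) (h : Descent k f R b x r θ)
    {c w p q s : ℝ} (hc : 1 ≤ c) (hp : 0 ≤ p) (hpq : p ≤ q) (hq : 0 < q) (hqs : q ≤ s)
    (hs : s ≤ b) (hqb : q < b) (hrp : r p = c + 1) (hrq : r q = c)
    (hx : ∀ u ∈ Icc 0 b, x u ≤ 1)
    (hN : ∀ u ∈ Icc p b, r u * Real.cos (θ u) - x u * Real.sin (θ u) < 0)
    (hw : w = Real.exp (-f ((c + 1) ^ 2 + 1) / 4)) :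
    w / (c ^ k * Real.exp (-f 0 / 4)) * (c - r s) ≤ r s * c := by
  have hw0 : 0 < w := hw ▸ Real.exp_pos _
  have hc0 : 0 < c := by linarith
  have hxq := h.x_pos q ⟨hq, hqb⟩
  obtain ⟨z, hz⟩ : ∃ z, z = x q / c := ⟨_, rfl⟩
  have hz0 : 0 < z := by rw [hz]; positivity
  have hmono : ∀ u ∈ Icc p q, z ≤ x u / r u := by
    intro u hu
    have key := image_le_of_hasDerivAt_nonpos (g := fun u => x u / r u) hu.2
      (fun v hv => (h.system v ⟨hp.trans (hu.1.trans hv.1), hv.2.trans hqb.le⟩).hasDerivAt_div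
        (h.r_pos v ⟨hp.trans (hu.1.trans hv.1), hv.2.trans hqb.le⟩).ne')
      (fun v hv => div_nonpos_of_nonpos_of_nonneg
        (hN v ⟨hu.1.trans hv.1.le, hv.2.le.trans hqb.le⟩).le
        (h.r_pos v ⟨hp.trans (hu.1.trans hv.1.le), hv.2.le.trans hqb.le⟩).le)
    simp only [hrq, ← hz] at key
    exact key
  have hdrop := h.weight_mul_support_add_le hf hk hp hpq hqb.le
    (by positivity : 0 ≤ w * z) (fun u hu => by
      have hu' : u ∈ Icc 0 b := ⟨hp.trans hu.1.le, hu.2.le.trans hqb.le⟩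
      have hr0 := h.r_pos u hu'
      have hru1 : 1 ≤ r u := hc.trans (hrq ▸ h.r_le hu'.1 hu.2.le hqb.le)
      have hru2 : r u ≤ c + 1 := hrp ▸ h.r_le hp hu.1.le hu'.2
      have hxu : z * r u ≤ x u := (le_div_iff₀ hr0).1 (hmono u (Ioo_subset_Icc_self hu))
      have hx0 := h.x_nonneg u hu'
      have hWw : w ≤ weight k f (x u) (r u) := by
        rw [hw, weight, ← one_mul (Real.exp (-f ((c + 1) ^ 2 + 1) / 4))]
        refine mul_le_mul (one_le_pow₀ hru1) (hf.exp_neg_le ?_) (Real.exp_pos _).le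
          (by positivity)
        have e1 : x u ^ 2 ≤ 1 := pow_le_one₀ hx0 (hx u hu')
        have e2 : r u ^ 2 ≤ (c + 1) ^ 2 := pow_le_pow_left₀ hr0.le hru2 2
        linarith
      rw [mul_assoc]
      exact mul_le_mul hWw hxu (by positivity) (hw0.le.trans hWw))
  have hWNp := mul_neg_of_pos_of_neg
    (weight_pos k f (a := x p) (h.r_pos p ⟨hp, hpq.trans hqb.le⟩)) (hN p ⟨le_rfl, hpq.trans hqb.le⟩)
  rw [show r p - r q = 1 by rw [hrp, hrq]; ring, mul_one] at hdrop
  obtain ⟨B, hB⟩ : ∃ B, B = c ^ k * Real.exp (-f 0 / 4) := ⟨_, rfl⟩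
  have hB0 : 0 < B := by rw [hB]; positivity
  rw [← hB]
  obtain ⟨μ, hμ⟩ : ∃ μ, μ = w / B := ⟨_, rfl⟩
  rw [← hμ]
  have hμ0 : 0 < μ := by rw [hμ]; positivity
  have hμB : μ * B = w := by rw [hμ]; field_simp
  have key := image_le_of_hasDerivAt_nonpos (g := fun u => x u / r u + μ * z / r u) hqs
    (fun u hu => ((h.system u ⟨hq.le.trans hu.1, hu.2.trans hs⟩).hasDerivAt_div
        (h.r_pos u ⟨hq.le.trans hu.1, hu.2.trans hs⟩).ne').add
      ((hasDerivAt_const u (μ * z)).div (h.system u ⟨hq.le.trans hu.1, hu.2.trans hs⟩).2.1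
        (h.r_pos u ⟨hq.le.trans hu.1, hu.2.trans hs⟩).ne')) (fun u hu => by
      have hu' : u ∈ Icc 0 b := ⟨hq.le.trans hu.1.le, hu.2.le.trans hs⟩
      have hr0 := h.r_pos u hu'
      have hru : r u ≤ c := hrq ▸ h.r_le hq.le hu.1.le hu'.2
      have hWN := h.weight_mul_support_lt hf hk hq.le hu.1 hu'.2
      have hNu := hN u ⟨hpq.trans hu.1.le, hu'.2⟩
      have hWB : weight k f (x u) (r u) ≤ B := by
        rw [hB, weight]
        exact mul_le_mul (pow_le_pow_left₀ hr0.le hru k) (hf.exp_neg_le (by positivity))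
          (Real.exp_pos _).le (by positivity)
      have h1 := mul_le_mul_of_nonpos_right hWB hNu.le
      obtain ⟨N, hNe⟩ : ∃ N, N = r u * Real.cos (θ u) - x u * Real.sin (θ u) := ⟨_, rfl⟩
      rw [← hNe] at h1 hWN ⊢
      have h2 : N ≤ -(μ * z) := by
        refine le_of_mul_le_mul_left ?_ hB0
        have : B * -(μ * z) = -(w * z) := by rw [← hμB]; ring
        linarith
      have h3 : N / r u + (0 * r u - μ * z * (r u * Real.sin (θ u))) / r u ^ 2 =
          (N - μ * z * Real.sin (θ u)) / r u := by
        field_simp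
        ring
      rw [h3]
      refine div_nonpos_of_nonpos_of_nonneg ?_ hr0.le
      have := mul_nonneg (mul_pos hμ0 hz0).le
        (by linarith [Real.neg_one_le_sin (θ u)] : 0 ≤ 1 + Real.sin (θ u))
      linarith)
  simp only [hrq, ← hz] at key
  have hsm : s ∈ Icc 0 b := ⟨hq.le.trans hqs, hs⟩
  have hrs := h.r_pos s hsm
  have h1 := div_nonneg (h.x_nonneg s hsm) hrs.le
  have h2 : μ * z / r s ≤ z + μ * z / c := by linarith
  rw [div_le_iff₀ hrs] at h2
  have h3 : (z + μ * z / c) * r s = z * (1 + μ / c) * r s := by ring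
  rw [h3, mul_comm μ z, mul_assoc] at h2
  have h4 := le_of_mul_le_mul_left h2 hz0
  have h5 : μ * c ≤ (1 + μ / c) * r s * c := mul_le_mul_of_nonneg_right h4 hc0.le
  have h6 : (1 + μ / c) * r s * c = (c + μ) * r s := by field_simp
  linarith

end Descent

namespace Descent

variable {k : ℕ} {m M : ℝ} {f : ℝ → ℝ} {R b : ℝ} {x r θ : ℝ → ℝ}

/-- A narrow vertical strand with negative support function cannot turn by a half circle. -/
theorem false_of_narrow_turn (hf : ConvexWeight m M f) (hk : 1 ≤ k) (h : Descent k f R b x r θ)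
    {c X B μ a v p : ℝ} (hc : 1 ≤ c) (hcm : 4 * (k : ℝ) ≤ c ^ 2 * m)
    (hB : B = c ^ k * Real.exp (-f 0 / 4))
    (hμ : μ = Real.exp (-f ((c + 1) ^ 2 + 1) / 4) / B) (ha : a = μ * c / (c + μ))
    (hv : v = a ^ k * Real.exp (-f (c ^ 2 + 1) / 4))
    (hX0 : 0 ≤ X) (hX1 : X ≤ 1) (hXc : 8 * X ≤ c) (hXa : X ≤ a / 4)
    (hXv : 4 * B * X + k * B * X * (2 * c / a) < v * (a / 4))
    (hθ : θ b = -Real.pi) (hx : ∀ u ∈ Icc 0 b, x u ≤ X)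
    (hp : p ∈ Icc 0 b) (hcos : Real.cos (θ p) = 0) (hrp : c + 1 ≤ r p)
    (hN : ∀ u ∈ Icc 0 b, r u ≤ c + 1 → r u * Real.cos (θ u) - x u * Real.sin (θ u) < 0) :
    False := by
  have hc0 : 0 < c := by linarith
  have hB0 : 0 < B := by rw [hB]; positivity
  have hμ0 : 0 < μ := by rw [hμ]; positivity
  have ha0 : 0 < a := by rw [ha]; positivity
  have hv0 : 0 < v := by rw [hv]; positivity
  have hη : 4 * X / c ≤ 1 / 2 := by rw [div_le_iff₀ hc0]; linarith
  have hrb : r b < c := by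
    by_contra hle
    have := h.neg_le_cos hf hc0 hcm hX0 hx hp.1 hp.2 le_rfl hcos (not_lt.1 hle)
    rw [hθ, Real.cos_neg, Real.cos_pi] at this
    linarith
  obtain ⟨i, hi, hri⟩ : (c + 1) ∈ r '' Icc p b :=
    intermediate_value_Icc' hp.2 (h.r_cont.mono (Icc_subset_Icc hp.1 le_rfl))
      ⟨by linarith, hrp⟩
  have hi0 := hp.1.trans hi.1
  obtain ⟨q, hq, hrq⟩ : c ∈ r '' Icc i b :=
    intermediate_value_Icc' hi.2 (h.r_cont.mono (Icc_subset_Icc hi0 le_rfl))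
      ⟨hrb.le, by linarith⟩
  have hiq : i < q := lt_of_le_of_ne hq.1 (by rintro rfl; linarith)
  have hqb : q < b := lt_of_le_of_ne hq.2 (by rintro rfl; linarith)
  have hq0 : 0 < q := hi0.trans_lt hiq
  have hra : ∀ u ∈ Icc q b, a ≤ r u := by
    intro u hu
    have key := h.le_r_of_support_neg hf hk hc hi0 hq.1 hq0 hu.1 hu.2 hqb hri hrq
      (fun u hu => (hx u hu).trans hX1)
      (fun u hu => hN u ⟨hi0.trans hu.1, hu.2⟩ (hri ▸ h.r_le hi0 hu.1 hu.2)) rfl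
    rw [← hB, ← hμ] at key
    rw [ha, div_le_iff₀ (by positivity)]
    linarith
  have hcosq := h.neg_le_cos hf hc0 hcm hX0 hx hp.1 (hi.1.trans hq.1) hqb.le hcos hrq.ge
  have hcosc : ContinuousOn (fun s => Real.cos (θ s)) (Icc q b) :=
    (Real.continuous_cos.comp_continuousOn h.θ_cont).mono (Icc_subset_Icc hq0.le le_rfl)
  obtain ⟨s, hs, hcs, hfirst⟩ := exists_first_hit (v := -(1 / 2)) hqb.le hcosc
    (by linarith) (by simp only [hθ, Real.cos_neg, Real.cos_pi]; norm_num)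
  have hWB : ∀ u ∈ Icc q b, weight k f (x u) (r u) ≤ B := by
    intro u hu
    have hr0 := h.r_pos u ⟨hq0.le.trans hu.1, hu.2⟩
    have hru : r u ≤ c := hrq ▸ h.r_le hq0.le hu.1 hu.2
    rw [hB, weight]
    exact mul_le_mul (pow_le_pow_left₀ hr0.le hru k) (hf.exp_neg_le (by positivity))
      (Real.exp_pos _).le (by positivity)
  have htime : s - q ≤ 2 * c / a := by
    have key := image_le_of_hasDerivAt_nonpos (g := fun u => r u + a / 2 * u) hs.1
      (fun u hu => (h.system u ⟨hq0.le.trans hu.1, hu.2.trans hs.2⟩).2.1.add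
        ((hasDerivAt_id u).const_mul (a / 2))) (fun u hu => by
        have hub := hu.2.le.trans hs.2
        have hau := hra u ⟨hu.1.le, hub⟩
        have h1 := hfirst u ⟨hu.1.le, hu.2.le⟩
        have h2 := h.cos_neg_of_lt hf hp.1 ((hi.1.trans hq.1).trans_lt hu.1) hub hcos.le
        have h3 := h.sin_nonpos u ⟨hq0.le.trans hu.1.le, hub⟩
        have h4 := Real.sin_sq_add_cos_sq (θ u)
        have h5 : Real.sin (θ u) ≤ -(1 / 2) := by
          by_contra hlt
          nlinarith
        have h6 : a * (1 / 2) ≤ r u * -Real.sin (θ u) :=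
          mul_le_mul hau (by linarith) (by norm_num) (ha0.le.trans hau)
        simp only [mul_one]
        linarith)
    have := hra s hs
    simp only [hrq] at key
    rw [le_div_iff₀ ha0]
    linarith
  have hflow := image_le_of_hasDerivAt_nonpos (g := fun u => -(weight k f (x u) (r u) *
      (r u * Real.cos (θ u) - x u * Real.sin (θ u)) + k * (B * X) * u)) hs.1
    (fun u hu => (((h.system u ⟨hq0.le.trans hu.1,
      hu.2.trans hs.2⟩).hasDerivAt_weight_mul_support hf).add
        ((hasDerivAt_id u).const_mul (k * (B * X)))).neg) (fun u hu => by
      have hub := hu.2.le.trans hs.2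
      have hu' : u ∈ Icc 0 b := ⟨hq0.le.trans hu.1.le, hub⟩
      have := mul_le_mul (hWB u ⟨hu.1.le, hub⟩) (hx u hu') (h.x_nonneg u hu') hB0.le
      have := mul_le_mul_of_nonneg_left this (k.cast_nonneg : (0 : ℝ) ≤ k)
      simp only [mul_one]
      linarith)
  have hqm : q ∈ Icc 0 b := ⟨hq0.le, hqb.le⟩
  have hsm : s ∈ Icc 0 b := ⟨hq0.le.trans hs.1, hs.2⟩
  have hstart : -(4 * B * X) ≤
      weight k f (x q) (r q) * (r q * Real.cos (θ q) - x q * Real.sin (θ q)) := by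
    have h1 : c * -(4 * X / c) ≤ c * Real.cos (θ q) := mul_le_mul_of_nonneg_left hcosq hc0.le
    have h2 : c * -(4 * X / c) = -(4 * X) := by field_simp
    have h3 := mul_nonneg (h.x_nonneg q hqm) (neg_nonneg.2 (h.sin_nonpos q hqm))
    have hW0 := weight_pos k f (a := x q) (h.r_pos q hqm)
    have h4 := mul_le_mul_of_nonneg_right (hWB q ⟨le_rfl, hqb.le⟩)
      (by positivity : 0 ≤ 4 * X)
    have h5 : -(4 * X) ≤ r q * Real.cos (θ q) - x q * Real.sin (θ q) := by
      rw [hrq]; linarith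
    have h6 := mul_le_mul_of_nonneg_left h5 hW0.le
    linarith
  have hend : weight k f (x s) (r s) * (r s * Real.cos (θ s) - x s * Real.sin (θ s)) ≤
      -(v * (a / 4)) := by
    have hr0 := h.r_pos s hsm
    have har := hra s hs
    have hrc : r s ≤ c := hrq ▸ h.r_le hq0.le hs.1 hs.2
    have hxs := hx s hsm
    have hx0 := h.x_nonneg s hsm
    have hvW : v ≤ weight k f (x s) (r s) := by
      rw [hv, weight]
      refine mul_le_mul (pow_le_pow_left₀ ha0.le har k) (hf.exp_neg_le ?_)
        (Real.exp_pos _).le (by positivity)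
      have e1 : x s ^ 2 ≤ 1 := pow_le_one₀ hx0 (hxs.trans hX1)
      have e2 : r s ^ 2 ≤ c ^ 2 := pow_le_pow_left₀ hr0.le hrc 2
      linarith
    have h1 : x s * -Real.sin (θ s) ≤ X * 1 :=
      mul_le_mul hxs (by linarith [Real.neg_one_le_sin (θ s)])
        (by linarith [h.sin_nonpos s hsm]) hX0
    have h2 : a / 4 ≤ -(r s * Real.cos (θ s) - x s * Real.sin (θ s)) := by
      rw [hcs]; linarith
    have h3 := mul_le_mul hvW h2 (by positivity) (hv0.le.trans hvW)
    linarith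
  have h1 : k * (B * X) * (s - q) ≤ k * (B * X) * (2 * c / a) :=
    mul_le_mul_of_nonneg_left htime (by positivity)
  linarith

end Descent

/-- The strand of a very high curve descends to the `r`-axis before making a half turn. -/
theorem ConvexWeight.exists_no_narrow_turn {k : ℕ} {m M : ℝ} {f : ℝ → ℝ}
    (hf : ConvexWeight m M f) (hk : 1 ≤ k) {c : ℝ} (hc : 1 ≤ c)
    (hcm : 4 * (k : ℝ) ≤ c ^ 2 * m) :
    ∃ X > 0, ∀ (R b : ℝ) (x r θ : ℝ → ℝ), Descent k f R b x r θ → θ b = -Real.pi →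
      (∀ u ∈ Icc 0 b, x u ≤ X) → ∀ p ∈ Icc 0 b, Real.cos (θ p) = 0 → c + 1 ≤ r p →
      (∀ u ∈ Icc 0 b, r u ≤ c + 1 → r u * Real.cos (θ u) - x u * Real.sin (θ u) < 0) →
      False := by
  have hc0 : 0 < c := by linarith
  obtain ⟨B, hB⟩ : ∃ B, B = c ^ k * Real.exp (-f 0 / 4) := ⟨_, rfl⟩
  have hB0 : 0 < B := by rw [hB]; positivity
  obtain ⟨μ, hμ⟩ : ∃ μ, μ = Real.exp (-f ((c + 1) ^ 2 + 1) / 4) / B := ⟨_, rfl⟩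
  have hμ0 : 0 < μ := by rw [hμ]; positivity
  obtain ⟨a, ha⟩ : ∃ a, a = μ * c / (c + μ) := ⟨_, rfl⟩
  have ha0 : 0 < a := by rw [ha]; positivity
  obtain ⟨v, hv⟩ : ∃ v, v = a ^ k * Real.exp (-f (c ^ 2 + 1) / 4) := ⟨_, rfl⟩
  have hv0 : 0 < v := by rw [hv]; positivity
  have hlim : Tendsto (fun X : ℝ => 4 * B * X + k * B * X * (2 * c / a)) (𝓝[>] 0) (𝓝 0) := by
    have : Continuous fun X : ℝ => 4 * B * X + k * B * X * (2 * c / a) := by fun_prop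
    simpa using (this.tendsto 0).mono_left nhdsWithin_le_nhds
  have hev := hlim.eventually_lt_const (by positivity : 0 < v * (a / 4))
  have h1 : ∀ᶠ X : ℝ in 𝓝[>] 0, X ∈ Ioo 0 (min (min 1 (c / 8)) (a / 4)) :=
    Ioo_mem_nhdsGT (by positivity)
  obtain ⟨X, hX, hX'⟩ := (hev.and h1).exists
  have e1 := hX'.2.le.trans (min_le_left _ _)
  have e2 := hX'.2.le.trans (min_le_right _ _)
  have e3 := e1.trans (min_le_left _ _)
  have e4 := e1.trans (min_le_right _ _)
  refine ⟨X, hX'.1, fun R b x r θ h hθ hx p hp hcos hrp hN => ?_⟩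
  exact h.false_of_narrow_turn hf hk hc hcm hB hμ ha hv hX'.1.le e3 (by linarith) e2 hX hθ hx hp
    hcos hrp hN

theorem Descent.support_neg_of_le {k : ℕ} {m M : ℝ} {f : ℝ → ℝ} {R b : ℝ} {x r θ : ℝ → ℝ}
    (hf : ConvexWeight m M f) (hk : 1 ≤ k) (hR : LargeRadius k m M R)
    (h : Descent k f R b x r θ) {u : ℝ} (hu : u ∈ Icc 0 b) (hru : r u ≤ R / 2) :
    r u * Real.cos (θ u) - x u * Real.sin (θ u) < 0 := by
  rcases hu.1.eq_or_lt with rfl | h0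
  · rw [h.r_zero] at hru
    linarith [h.radius_pos]
  · exact (h.restrict h0 hu.2).support_neg hf hk hR hru

theorem ShootingFamily.returnsEarly_of_largeRadius {k : ℕ} {m M : ℝ} {f : ℝ → ℝ}
    (hf : ConvexWeight m M f) (hk : 1 ≤ k) {R₁ R K c X : ℝ} {x r θ : ℝ → ℝ → ℝ}
    (F : ShootingFamily k f K x r θ) (hR₁ : 0 < R₁)
    (hg : R₁ ^ 2 * deriv f (R₁ ^ 2) / 2 = (k : ℝ) + 1)
    (hX : ∀ (R b : ℝ) (x r θ : ℝ → ℝ), Descent k f R b x r θ → θ b = -Real.pi →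
      (∀ u ∈ Icc 0 b, x u ≤ X) → ∀ p ∈ Icc 0 b, Real.cos (θ p) = 0 → c + 1 ≤ r p →
      (∀ u ∈ Icc 0 b, r u ≤ c + 1 → r u * Real.cos (θ u) - x u * Real.sin (θ u) < 0) → False)
    (hRK : R < K) (hR : LargeRadius k m M R) (hRR : 2 * R₁ ≤ R) (hcR : 2 * (c + 1) ≤ R)
    (hXR : 8 * Real.pi / (R * m) ≤ X) : ReturnsEarly K x r θ R := by
  have hR0 : 0 < R := by linarith [hR.eight_le]
  have hgR := hf.lt_of_sphere_radius_lt hR₁ hg (by linarith : R₁ < R)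
  obtain ⟨ε, hε, hstart⟩ := F.eventually_inRegion_start hf hR0 hRK hgR
  have cx := F.continuous_x R
  have cr := F.continuous_r R
  have cθ := F.continuous_θ R
  rcases forall_mem_or_exists_first_exit (isOpen_inRegion K)
    (by fun_prop : Continuous fun s => (x R s, r R s, θ R s)) hε hstart.self_of_nhds with
    hall | ⟨s₁, hs₁, hin, hout⟩
  · exfalso
    have D : ∀ b > 0, Descent k f R b (x R) (r R) (θ R) :=
      fun b hb => F.descent hR0 hRK.le hb fun s hs => hall s hs.1
    obtain ⟨s, hs, hrs⟩ := Descent.exists_r_lt_of_forever hf hk D (half_pos hR0)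
    have h0 : 0 < s := by linarith
    have hN := (D s h0).support_neg hf hk hR hrs.le
    have hcos := Descent.cos_pos_of_forever hf hk D h0.le
    have hr := (hall s h0).r_pos
    have hxp := (hall s h0).x_pos
    have hsin := (D (s + 1) (by linarith)).sin_neg s ⟨h0, by linarith⟩
    nlinarith [mul_pos hr hcos, mul_pos hxp (neg_pos.2 hsin)]
  · have D := F.descent hR0 hRK.le hs₁ hin
    have hmem : s₁ ∈ Icc 0 s₁ := ⟨hs₁.le, le_rfl⟩
    have hθ0 := D.θ_nonpos s₁ hmem
    have hθπ := D.θ_ge s₁ hmem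
    have hT := D.radial_nonpos s₁ hmem
    have hr := D.r_pos s₁ hmem
    rcases hθπ.eq_or_lt with hθ | hθ
    · exfalso
      obtain ⟨p, hp, hcos⟩ := D.exists_cos_eq_zero hmem
        (by rw [← hθ, Real.cos_neg, Real.cos_pi]; norm_num)
      have hpm := Ioo_subset_Icc_self hp
      have hrp : R / 2 ≤ r R p := by
        by_contra hlt
        have h1 := D.support_neg_of_le hf hk hR hpm (not_le.1 hlt).le
        have h2 := mul_pos (D.x_pos p hp) (neg_pos.2 (D.sin_neg p hp))
        rw [hcos] at h1
        linarith
      have hxp := (D.x_le_of_half_le hf hR hpm hrp).trans hXR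
      refine hX R s₁ _ _ _ D hθ.symm (fun u hu => ?_) p hpm hcos (by linarith)
        fun u hu hru => D.support_neg_of_le hf hk hR hu (by linarith)
      rcases lt_trichotomy u p with hup | rfl | hup
      · exact (D.x_lt_of_cos_nonneg hf hu.1 hup hp.2.le hcos.ge).le.trans hxp
      · exact hxp
      · exact (D.x_lt_of_cos_nonpos hf hp.1.le hup hu.2 hcos.le).le.trans hxp
    · rcases (D.x_nonneg s₁ hmem).eq_or_lt with hx | hx
      · exact ⟨s₁, hs₁, hin, hx.symm, hθ,
          D.θ_lt_of_cos_neg hmem (D.cos_neg_of_x_eq_zero hf hx.symm)⟩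
      · exfalso
        have hT0 : x R s₁ * Real.cos (θ R s₁) + r R s₁ * Real.sin (θ R s₁) = 0 := by
          by_contra hne
          refine hout ⟨hx, hr, hθ, lt_of_le_of_ne hθ0 ?_, lt_of_le_of_ne hT hne,
            (D.normSq_le hmem).trans_lt (by nlinarith)⟩
          intro h0
          rw [show θ R s₁ = 0 from h0] at hT
          simp at hT
          linarith
        have h1 := D.normSq_mul_deriv_lt hf hT0
        have h2 : x R s₁ ^ 2 + r R s₁ ^ 2 < R₁ ^ 2 := by
          by_contra hge
          rcases (not_lt.1 hge).eq_or_lt with he | hl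
          · rw [← he] at h1
            linarith
          · have := hf.mul_deriv_lt (sq_nonneg R₁) hl
            linarith
        have h3 : r R s₁ < R₁ := by nlinarith [sq_nonneg (x R s₁)]
        have hN := D.support_neg hf hk hR (by linarith)
        have hsin := D.sin_nonpos s₁ hmem
        have hcos : 0 ≤ Real.cos (θ R s₁) := by
          have := mul_nonneg hr.le (neg_nonneg.2 hsin)
          exact nonneg_of_mul_nonneg_right (by linarith : 0 ≤ x R s₁ * Real.cos (θ R s₁)) hx
        have := mul_nonneg hr.le hcos
        have := mul_nonneg hx.le (neg_nonneg.2 hsin)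
        linarith

/-- Some curve closes up perfectly. -/
theorem ConvexWeight.exists_perfect_return {k : ℕ} {m M : ℝ} {f : ℝ → ℝ}
    (hf : ConvexWeight m M f) (hk : 1 ≤ k) :
    ∃ (R s₁ : ℝ) (x r θ : ℝ → ℝ), Continuous r ∧ Descent k f R s₁ x r θ ∧ x s₁ = 0 ∧
      θ s₁ = -Real.pi := by
  have hm := hf.pos
  have hM : 0 < M := hm.trans_le ((hf.low 0).trans (hf.up 0))
  obtain ⟨R₁, hR₁, hg⟩ := hf.exists_sphere_radius k
  obtain ⟨c, hc, hcm⟩ : ∃ c : ℝ, 1 ≤ c ∧ 4 * (k : ℝ) ≤ c ^ 2 * m := by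
    refine ⟨1 + 4 * k / m, by linarith [show 0 ≤ 4 * (k : ℝ) / m by positivity], ?_⟩
    have e : 4 * (k : ℝ) / m * m = 4 * k := by field_simp
    have h0 : 0 ≤ 4 * (k : ℝ) / m := by positivity
    nlinarith [mul_nonneg (mul_nonneg h0 h0) hm.le]
  obtain ⟨X, hX0, hX⟩ := hf.exists_no_narrow_turn hk hc hcm
  have hev := eventually_largeRadius k hm hM
  obtain ⟨R₂, hL, hRR, hcR, hXR⟩ := (hev.and ((eventually_ge_atTop (2 * R₁)).and
    ((eventually_ge_atTop (2 * (c + 1))).and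
      (eventually_ge_atTop (8 * Real.pi / (X * m)))))).exists
  have hR₂ : 0 < R₂ := by linarith
  have hXR' : 8 * Real.pi / (R₂ * m) ≤ X := by
    rw [div_le_iff₀ (by positivity)] at hXR ⊢
    linarith
  obtain ⟨x, r, θ, F⟩ := hf.exists_shootingFamily k (by linarith : 0 ≤ R₂ + 1)
  have hlarge := F.returnsEarly_of_largeRadius hf hk hR₁ hg hX (by linarith) hL hRR hcR hXR'
  set A : Set ℝ := {R | R ∈ Icc R₁ R₂ ∧ ¬ ReturnsEarly (R₂ + 1) x r θ R} with hA
  have hsph := F.eventually_not_returnsEarly_of_sphere hf hk hR₁ (by linarith) hg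
  have hne : A.Nonempty := ⟨R₁, ⟨le_rfl, by linarith⟩, hsph.self_of_nhds⟩
  have hbdd : BddAbove A := ⟨R₂, fun R hR => hR.1.2⟩
  obtain ⟨R, hRdef⟩ : ∃ R, R = sSup A := ⟨_, rfl⟩
  have hR1 : R₁ ≤ R := hRdef ▸ le_csSup hbdd ⟨⟨le_rfl, by linarith⟩, hsph.self_of_nhds⟩
  have hR2 : R ≤ R₂ := hRdef ▸ csSup_le hne fun R hR => hR.1.2
  have habove : ∀ R', R < R' → R' ≤ R₂ → ReturnsEarly (R₂ + 1) x r θ R' := by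
    intro R' h1 h2
    by_contra hnot
    exact absurd (le_csSup hbdd (show R' ∈ A from ⟨⟨hR1.trans h1.le, h2⟩, hnot⟩))
      (not_le.2 (hRdef ▸ h1))
  have hR0 : 0 < R := hR₁.trans_le hR1
  have hnot : ¬ ReturnsEarly (R₂ + 1) x r θ R := by
    intro hret
    rcases hR1.eq_or_lt with he | hlt
    · exact hsph.self_of_nhds (he ▸ hret)
    · have hev := F.eventually_returnsEarly hf hR0 (by linarith)
        (hf.lt_of_sphere_radius_lt hR₁ hg hlt) hret
      obtain ⟨l, hl, hlR⟩ := exists_Ioc_subset_of_mem_nhds hev ⟨R - 1, by linarith⟩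
      obtain ⟨R', hR', hlt'⟩ := exists_lt_of_lt_csSup hne (hRdef ▸ hl : l < sSup A)
      exact hR'.2 (hlR ⟨hlt', hRdef ▸ le_csSup hbdd hR'⟩)
  have hRlt : R < R₂ := lt_of_le_of_ne hR2 (by rintro rfl; exact hnot hlarge)
  have hfreq : ∃ᶠ R' in 𝓝 R, ReturnsEarly (R₂ + 1) x r θ R' := by
    have h1 : ∀ᶠ R' in 𝓝[>] R, ReturnsEarly (R₂ + 1) x r θ R' := by
      filter_upwards [Ioo_mem_nhdsGT hRlt] with R' hR'
      exact habove R' hR'.1 hR'.2.le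
    exact h1.frequently.filter_mono nhdsWithin_le_nhds
  have hR1' : R₁ < R := by
    refine lt_of_le_of_ne hR1 ?_
    rintro he
    rw [← he] at hfreq
    exact hfreq hsph
  obtain ⟨s₁, D, hx, hθ⟩ := F.exists_perfect_return hf hk hR0 (by linarith)
    (hf.lt_of_sphere_radius_lt hR₁ hg hR1') hnot hfreq
  exact ⟨R, s₁, x R, r R, θ R, F.continuous_r R, D, hx, hθ⟩

theorem exists_time_change {ρ : ℝ → ℝ} {δ : ℝ} (hρ : Continuous ρ) (hδ : 0 < δ)
    (h : ∀ s, δ ≤ ρ s) :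
    ∃ σ τ : ℝ → ℝ, σ 0 = 0 ∧ StrictMono σ ∧ (∀ s, σ (τ s) = s) ∧
      ∀ t, HasDerivAt σ (ρ (σ t))⁻¹ t := by
  obtain ⟨τ, hτ⟩ : ∃ τ : ℝ → ℝ, τ = fun s => ∫ u in (0 : ℝ)..s, ρ u := ⟨_, rfl⟩
  have hd : ∀ s, HasDerivAt τ (ρ s) s := fun s => hτ ▸ hρ.integral_hasStrictDerivAt 0 s |>.hasDerivAt
  have h0 : τ 0 = 0 := by simp [hτ]
  have hc : Continuous τ := continuous_iff_continuousAt.2 fun s => (hd s).continuousAt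
  have hgrow : ∀ a b, a ≤ b → δ * (b - a) ≤ τ b - τ a := by
    intro a b hab
    have := image_le_of_hasDerivAt_nonpos (g := fun s => δ * s - τ s) hab
      (fun s _ => ((hasDerivAt_id s).const_mul δ).sub (hd s)) (fun s _ => by linarith [h s])
    linarith
  have hmono : StrictMono τ := fun a b hab => by
    have := hgrow a b hab.le
    have := mul_pos hδ (sub_pos.2 hab)
    linarith
  have htop : Tendsto τ atTop atTop := by
    refine tendsto_atTop_mono' _ ?_ (tendsto_id.const_mul_atTop hδ)
    filter_upwards [eventually_ge_atTop 0] with s hs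
    have := hgrow 0 s hs
    simp only [h0, id] at *
    linarith
  have hbot : Tendsto τ atBot atBot := by
    refine tendsto_atBot_mono' _ ?_ (tendsto_id.const_mul_atBot hδ)
    filter_upwards [eventually_le_atBot 0] with s hs
    have := hgrow s 0 hs
    simp only [h0, id] at *
    linarith
  have hsurj := hc.surjective htop hbot
  obtain ⟨e, he⟩ : ∃ e : ℝ ≃o ℝ, ∀ s, e s = τ s :=
    ⟨StrictMono.orderIsoOfSurjective τ hmono hsurj, fun s => rfl⟩
  refine ⟨e.symm, τ, ?_, e.symm.strictMono, fun s => by rw [← he, e.symm_apply_apply], fun t => ?_⟩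
  · rw [e.symm_apply_eq, he, h0]
  · refine HasDerivAt.of_local_left_inverse (f := τ) e.symm.continuous.continuousAt (hd _)
      (hδ.trans_le (h _)).ne' (Eventually.of_forall fun u => ?_)
    rw [← he, e.apply_symm_apply]

/-- The arc-length parametrization of a curve solving the conformal system. -/
theorem Descent.exists_arcLength {k : ℕ} {f : ℝ → ℝ} {R b : ℝ} {x r θ : ℝ → ℝ}
    (h : Descent k f R b x r θ) (hr : Continuous r) :
    ∃ (σ : ℝ → ℝ) (T : ℝ), 0 < T ∧ σ 0 = 0 ∧ σ T = b ∧ StrictMono σ ∧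
      SolvesSystem (k + 1) f (x ∘ σ) (r ∘ σ) (θ ∘ σ) (Icc 0 T) := by
  have hb := h.end_pos
  have hrb := h.r_pos b ⟨hb.le, le_rfl⟩
  obtain ⟨σ, τ, hσ0, hmono, hστ, hσ⟩ := exists_time_change (ρ := fun s => max (r s) (r b))
    (by fun_prop) hrb (fun s => le_max_right _ _)
  refine ⟨σ, τ b, ?_, hσ0, hστ b, hmono, fun t ht => ?_⟩
  · rw [← hmono.lt_iff_lt, hσ0, hστ]
    exact hb
  · have hmem : σ t ∈ Icc 0 b := by
      have h1 := hmono.monotone ht.1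
      have h2 := hmono.monotone ht.2
      rw [hσ0] at h1
      rw [hστ] at h2
      exact ⟨h1, h2⟩
    have hmax : max (r (σ t)) (r b) = r (σ t) := max_eq_left (h.r_le hmem.1 hmem.2 le_rfl)
    have hσt := hσ t
    simp only [hmax] at hσt
    have hr0 := (h.r_pos _ hmem).ne'
    obtain ⟨h1, h2, h3⟩ := h.system _ hmem
    refine ⟨(h1.comp t hσt).congr_deriv ?_, (h2.comp t hσt).congr_deriv ?_,
      (h3.comp t hσt).congr_deriv ?_⟩
    · simp only [Function.comp_apply]
      field_simp
    · simp only [Function.comp_apply]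
      field_simp
    · simp only [Function.comp_apply]
      push_cast
      field_simp
      ring

end

/-- There exists `R* > 0` whose solution of (1.5)–(1.6) has a finite first exit time `t₁`
with `x(t₁) = 0`, `θ(t₁) = -π` and `r(t₁) > 0`. -/
theorem exists_good_shooting_parameter
    (n : ℕ) (hn : 2 ≤ n) (m M : ℝ) (hm : 0 < m) (hmM : m ≤ M)
    (f : ℝ → ℝ) (hf : ContDiff ℝ 2 f)
    (hconv : ∀ s : ℝ, 0 ≤ deriv (deriv f) s)
    (hlow : ∀ s : ℝ, m ≤ deriv f s) (hup : ∀ s : ℝ, deriv f s ≤ M) :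
    ∃ R : ℝ, 0 < R ∧ ∃ x r θ : ℝ → ℝ, ∃ t₁ : ℝ, 0 < t₁ ∧
      x 0 = 0 ∧ r 0 = R ∧ θ 0 = 0 ∧
      SolvesSystem n f x r θ (Set.Icc 0 t₁) ∧
      NoExit x r θ (Set.Ioo 0 t₁) ∧
      x t₁ = 0 ∧ θ t₁ = -Real.pi ∧ 0 < r t₁ := by
  obtain ⟨k, rfl⟩ : ∃ k, n = k + 1 := ⟨n - 1, by omega⟩
  have hd : Differentiable ℝ (deriv f) :=
    ((contDiff_succ_iff_deriv (n := 1)).1 hf).2.2.differentiable (by norm_num)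
  have hcw : ConvexWeight m M f := ⟨hm, hf, monotone_of_deriv_nonneg hd hconv, hlow, hup⟩
  obtain ⟨R, s₁, x, r, θ, hr, D, hx, hθ⟩ := hcw.exists_perfect_return (by omega : 1 ≤ k)
  obtain ⟨σ, T, hT, hσ0, hσT, hmono, hsys⟩ := D.exists_arcLength hr
  have hb := D.end_pos
  refine ⟨R, D.radius_pos, x ∘ σ, r ∘ σ, θ ∘ σ, T, hT, by simp [hσ0, D.x_zero],
    by simp [hσ0, D.r_zero], by simp [hσ0, D.θ_zero], hsys, fun t ht => ?_,
    by simp [hσT, hx], by simp [hσT, hθ], ?_⟩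
  · have hmem : σ t ∈ Set.Ioo 0 s₁ := by
      rw [← hσ0, ← hσT]
      exact ⟨hmono ht.1, hmono ht.2⟩
    exact ⟨(D.θ_neg _ hmem).ne, (D.θ_gt _ hmem).ne', (D.x_pos _ hmem).ne',
      (D.r_pos _ (Set.Ioo_subset_Icc_self hmem)).ne'⟩
  · simp only [Function.comp_apply, hσT]
    exact D.r_pos s₁ ⟨hb.le, le_rfl⟩
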